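/- Assume (h1), (h2) and (f1)–(f4). Then the Nehari set M is nonempty and the infimum c = inf_{u∈M} J̃(u) is attained: there exists u₀ ∈ M with J̃(u₀) = c > 0. -/

import Mathlib

open MeasureTheory Filter Topology
open scoped ENNReal

noncomputable section

namespace DiscreteChoquard

variable {d : ℕ}

/-- The lattice `ℤ^d`. -/
abbrev Z (d : ℕ) := Fin d → ℤ

/-- Graph distance on `ℤ^d`, as a real number. -/
def latDist (x y : Z d) : ℝ := ∑ i, |((x i - y i : ℤ) : ℝ)|

/-- The kernel hypotheses on `W_s`: symmetry, positivity, and the two-sided bound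
`c|x−y|^{−d−2s} ≤ W_s(x,y) ≤ C|x−y|^{−d−2s}` for `x ≠ y`. -/
def KernelOK (d : ℕ) (s : ℝ) (W : Z d → Z d → ℝ) : Prop :=
  (∀ x y, W x y = W y x) ∧ (∀ x y, 0 < W x y) ∧
  ∃ c C : ℝ, 0 < c ∧ c ≤ C ∧ ∀ x y : Z d, x ≠ y →
    c * latDist x y ^ (-(d : ℝ) - 2 * s) ≤ W x y ∧
      W x y ≤ C * latDist x y ^ (-(d : ℝ) - 2 * s)

/-- The fractional gradient form `∇^s u ∇^s v (x)`.  (The `y = x` summand vanishes, so we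
sum over all `y`.) -/
def gradForm (W : Z d → Z d → ℝ) (u v : Z d → ℝ) (x : Z d) : ℝ :=
  (1 / 2) * ∑' y : Z d, W x y * (u x - u y) * (v x - v y)

/-- `|∇^s u|(x)`. -/
def gradNorm (W : Z d → Z d → ℝ) (u : Z d → ℝ) (x : Z d) : ℝ :=
  Real.sqrt ((1 / 2) * ∑' y : Z d, W x y * (u x - u y) ^ 2)

/-- The fractional `p`-Laplacian `(−Δ)_p^s u (x)`. -/
def pLap (W : Z d → Z d → ℝ) (p : ℝ) (u : Z d → ℝ) (x : Z d) : ℝ :=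
  (1 / 2) * ∑' y : Z d,
    W x y * (gradNorm W u x ^ (p - 2) + gradNorm W u y ^ (p - 2)) * (u x - u y)

/-- `‖u‖_{H_{s,p}}^p = ∑_x (|∇^s u|^p(x) + h(x)|u(x)|^p)`. -/
def HnormP (W : Z d → Z d → ℝ) (h : Z d → ℝ) (p : ℝ) (u : Z d → ℝ) : ℝ :=
  ∑' x : Z d, (gradNorm W u x ^ p + h x * |u x| ^ p)

/-- `‖u‖_{H_{s,p}}`. -/
def normH (W : Z d → Z d → ℝ) (h : Z d → ℝ) (p : ℝ) (u : Z d → ℝ) : ℝ :=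
  HnormP W h p u ^ (1 / p)

/-- Membership `u ∈ H_{s,p}`, i.e. `‖u‖_{H_{s,p}} < ∞` (all the defining series converge). -/
def memH (W : Z d → Z d → ℝ) (h : Z d → ℝ) (p : ℝ) (u : Z d → ℝ) : Prop :=
  (∀ x : Z d, Summable fun y : Z d => W x y * (u x - u y) ^ 2) ∧
  Summable fun x : Z d => gradNorm W u x ^ p + h x * |u x| ^ p

/-- The `ℓ^q` norm on `ℤ^d`. -/
def lnorm (q : ℝ) (u : Z d → ℝ) : ℝ := (∑' x : Z d, |u x| ^ q) ^ (1 / q)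

/-- The torus box `[0, 2π]^d`. -/
def box (d : ℕ) : Set (Fin d → ℝ) := Set.univ.pi fun _ => Set.Icc 0 (2 * Real.pi)

/-- `μ(k) = 2d − 2 ∑_j cos k_j`. -/
def muk (d : ℕ) (k : Fin d → ℝ) : ℝ := 2 * d - 2 * ∑ j, Real.cos (k j)

/-- The fractional degree `K_α = (2π)^{-d} ∫_{[0,2π]^d} μ(k)^{α/2} dk`. -/
def Kfrac (d : ℕ) (α : ℝ) : ℝ :=
  (2 * Real.pi) ^ (-(d : ℝ)) * ∫ k in box d, muk d k ^ (α / 2)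

/-- The Green's function `R_α(x,y)` of the discrete fractional Laplacian. -/
def Riesz (d : ℕ) (α : ℝ) (x y : Z d) : ℝ :=
  Kfrac d α * (2 * Real.pi) ^ (-(d : ℝ)) *
    ∫ k in box d, Real.cos (∑ j, ((x j - y j : ℤ) : ℝ) * k j) * muk d k ^ (-(α / 2))

/-- The convolution `(R_α ∗ v)(x) = ∑_y R_α(x,y) v(y)`. -/
def conv (d : ℕ) (α : ℝ) (v : Z d → ℝ) (x : Z d) : ℝ := ∑' y : Z d, Riesz d α x y * v y

/-- `F(t) = ∫_0^t f(r) dr`. -/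
def Fint (f : ℝ → ℝ) (t : ℝ) : ℝ := ∫ r in (0 : ℝ)..t, f r

/-- Positive part `u⁺ = max(u,0)`. -/
def pos (u : Z d → ℝ) (x : Z d) : ℝ := max (u x) 0

/-- Negative part `u⁻ = min(u,0)`. -/
def negp (u : Z d → ℝ) (x : Z d) : ℝ := min (u x) 0

/-- Hypothesis (h2): `h(x) → ∞` as `|x| → ∞`. -/
def H2 (h : Z d → ℝ) : Prop := Tendsto h cofinite atTop

/-- Hypothesis (f1): `f(t) = o(t^{p−1})` as `t → 0⁺`. -/
def F1 (f : ℝ → ℝ) (p : ℝ) : Prop :=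
  ∀ ε > (0 : ℝ), ∃ δ > (0 : ℝ), ∀ t : ℝ, 0 < t → t < δ → |f t| ≤ ε * t ^ (p - 1)

/-- Hypothesis (f3): `0 ≤ θ F(t) ≤ 2 f(t) t` for `t > 0`. -/
def F3 (f : ℝ → ℝ) (θ : ℝ) : Prop :=
  ∀ t > (0 : ℝ), 0 ≤ θ * Fint f t ∧ θ * Fint f t ≤ 2 * f t * t

/-- The energy functional `J̃`. -/
def energy (W : Z d → Z d → ℝ) (h : Z d → ℝ) (p α : ℝ) (f : ℝ → ℝ) (u : Z d → ℝ) : ℝ :=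
  (1 / p) * HnormP W h p u -
    (1 / 2) * ∑' x : Z d, conv d α (fun y => Fint f (pos u y)) x * Fint f (pos u x)

/-- The Nehari set `M`. -/
def Nehari (W : Z d → Z d → ℝ) (h : Z d → ℝ) (p α : ℝ) (f : ℝ → ℝ) : Set (Z d → ℝ) :=
  {u | memH W h p u ∧ u ≠ 0 ∧
    HnormP W h p u =
      ∑' x : Z d, conv d α (fun y => Fint f (pos u y)) x * f (pos u x) * pos u x}

/-- Hypothesis (f4). -/
def F4 (W : Z d → Z d → ℝ) (h : Z d → ℝ) (p α : ℝ) (f : ℝ → ℝ) : Prop :=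
  ∀ u : Z d → ℝ, memH W h p u → pos u ≠ 0 →
    StrictMonoOn (fun t : ℝ =>
      t ^ (1 - p) *
        ∑' x : Z d, conv d α (fun y => Fint f (t * pos u y)) x * f (t * pos u x) * pos u x)
      (Set.Ioi 0)

/-- The derivative pairing `⟨J̃′(u), φ⟩`. -/
def pairing (W : Z d → Z d → ℝ) (h : Z d → ℝ) (p α : ℝ) (f : ℝ → ℝ) (u φ : Z d → ℝ) : ℝ :=
  (∑' x : Z d,
      (gradNorm W u x ^ (p - 2) * gradForm W u φ x + h x * |u x| ^ (p - 2) * u x * φ x)) -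
    ∑' x : Z d, conv d α (fun y => Fint f (pos u y)) x * f (pos u x) * φ x


/-! ### The Riesz kernel: boundedness and positivity -/

lemma box_restrict (d : ℕ) : (volume.restrict (box d) : Measure (Fin d → ℝ)) =
    Measure.pi (fun _ => volume.restrict (Set.Ioo (0 : ℝ) (2 * Real.pi))) := by
  rw [box, volume_pi, Measure.restrict_pi_pi]
  congr 1
  funext i
  exact Measure.restrict_congr_set Ioo_ae_eq_Icc.symm

lemma box_ae (d : ℕ) : ∀ᵐ k ∂(volume.restrict (box d) : Measure (Fin d → ℝ)),
    ∀ j, k j ∈ Set.Ioo (0 : ℝ) (2 * Real.pi) := by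
  rw [box_restrict, ← Measure.restrict_pi_pi]
  have := ae_restrict_mem (μ := Measure.pi (fun _ : Fin d => (volume : Measure ℝ)))
    (MeasurableSet.univ_pi (t := fun _ : Fin d => Set.Ioo (0 : ℝ) (2 * Real.pi))
      fun _ => measurableSet_Ioo)
  filter_upwards [this] with k hk j using hk j (Set.mem_univ _)

lemma zcos_pos {k : ℝ} (hk : k ∈ Set.Ioo (0 : ℝ) (2 * Real.pi)) : 0 < 2 - 2 * Real.cos k := by
  have h1 : Real.cos k ≠ 1 := by
    intro h
    rw [Real.cos_eq_one_iff_of_lt_of_lt (by linarith [hk.1, Real.pi_pos]) hk.2] at h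
    exact hk.1.ne' h
  have h2 := lt_of_le_of_ne (Real.cos_le_one k) h1
  linarith

lemma zcos_integrable {b : ℝ} (hb : 0 < b) (hb' : 2 * b < 1) :
    Integrable (fun k : ℝ => (2 - 2 * Real.cos k) ^ (-b))
      (volume.restrict (Set.Ioo (0 : ℝ) (2 * Real.pi))) := by
  have hpi := Real.pi_pos
  have i1 : IntervalIntegrable (fun k : ℝ => k ^ (-(2 * b))) volume 0 (2 * Real.pi) :=
    intervalIntegral.intervalIntegrable_rpow' (by linarith)
  have i2 : IntervalIntegrable (fun k : ℝ => (2 * Real.pi - k) ^ (-(2 * b))) volume 0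
      (2 * Real.pi) := by
    have := i1.comp_sub_left (2 * Real.pi)
    simpa using this.symm
  have i3 := ((i1.add i2).const_mul ((4 / Real.pi ^ 2) ^ (-b)))
  rw [intervalIntegrable_iff_integrableOn_Ioo_of_le (by positivity)] at i3
  refine i3.mono' (Measurable.aestronglyMeasurable (by fun_prop)) ?_
  refine (ae_restrict_mem measurableSet_Ioo).mono fun k hk => ?_
  have hz := zcos_pos hk
  rw [Real.norm_of_nonneg (by positivity)]
  have key : ∀ y : ℝ, 0 < y → y ≤ Real.pi →
      (2 - 2 * Real.cos y) ^ (-b) ≤ (4 / Real.pi ^ 2) ^ (-b) * y ^ (-(2 * b)) := by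
    intro y hy hy'
    have hc := Real.cos_le_one_sub_mul_cos_sq (x := y) (by rwa [abs_of_pos hy])
    have : (4 / Real.pi ^ 2) * y ^ 2 ≤ 2 - 2 * Real.cos y := by
      have : (4 / Real.pi ^ 2) * y ^ 2 = 2 * (2 / Real.pi ^ 2 * y ^ 2) := by ring
      linarith
    calc (2 - 2 * Real.cos y) ^ (-b) ≤ ((4 / Real.pi ^ 2) * y ^ 2) ^ (-b) :=
          Real.rpow_le_rpow_of_nonpos (by positivity) this (by linarith)
      _ = _ := by
          rw [Real.mul_rpow (by positivity) (by positivity), ← Real.rpow_natCast_mul hy.le]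
          norm_num
  have h1 : 0 ≤ k ^ (-(2 * b)) := Real.rpow_nonneg hk.1.le _
  have h2 : 0 ≤ (2 * Real.pi - k) ^ (-(2 * b)) := Real.rpow_nonneg (by linarith [hk.2]) _
  have h3 : 0 ≤ (4 / Real.pi ^ 2) ^ (-b) := by positivity
  rcases le_total k Real.pi with hkp | hkp
  · refine (key k hk.1 hkp).trans ?_
    gcongr
    simpa using h2
  · have := key (2 * Real.pi - k) (by linarith [hk.2]) (by linarith)
    rw [Real.cos_two_pi_sub] at this
    refine this.trans ?_
    gcongr
    simpa using h1

lemma muk_eq (d : ℕ) (k : Fin d → ℝ) : muk d k = ∑ j, (2 - 2 * Real.cos (k j)) := by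
  simp [muk, Finset.sum_sub_distrib, Finset.mul_sum, mul_comm]

lemma muk_nonneg (d : ℕ) (k : Fin d → ℝ) : 0 ≤ muk d k := by
  rw [muk_eq]
  exact Finset.sum_nonneg fun j _ => by linarith [Real.cos_le_one (k j)]

lemma muk_measurable (d : ℕ) : Measurable (muk d) := by
  unfold muk; fun_prop

lemma muk_integrable {d : ℕ} (hd : 0 < d) {α : ℝ} (hα : α ∈ Set.Ioo (0 : ℝ) (d : ℝ)) :
    Integrable (fun k => muk d k ^ (-(α / 2))) (volume.restrict (box d)) := by
  have hd' : (0 : ℝ) < d := by exact_mod_cast hd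
  have hα0 := hα.1
  have hα1 := hα.2
  have hprod : Integrable (fun k : Fin d → ℝ => ∏ j, (2 - 2 * Real.cos (k j)) ^ (-(α / (2 * d))))
      (volume.restrict (box d)) := by
    rw [box_restrict]
    refine Integrable.fintype_prod (f := fun _ k => (2 - 2 * Real.cos k) ^ (-(α / (2 * d))))
      fun _ => zcos_integrable (by positivity) ?_
    rw [show 2 * (α / (2 * d)) = α / d by field_simp, div_lt_one hd']
    exact hα1
  refine hprod.mono' ((muk_measurable d).pow_const _).aestronglyMeasurable ?_
  filter_upwards [box_ae d] with k hk
  have hz : ∀ j, 0 < 2 - 2 * Real.cos (k j) := fun j => zcos_pos (hk j)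
  rw [Real.norm_of_nonneg (Real.rpow_nonneg (muk_nonneg d k) _)]
  have amgm := Real.geom_mean_le_arith_mean_weighted Finset.univ (fun _ : Fin d => (1 / d : ℝ))
    (fun j => 2 - 2 * Real.cos (k j)) (fun _ _ => by positivity)
    (by simp; field_simp) (fun j _ => (hz j).le)
  rw [← Finset.mul_sum, ← muk_eq] at amgm
  have hle : ∏ j, (2 - 2 * Real.cos (k j)) ^ (1 / d : ℝ) ≤ muk d k := by
    refine amgm.trans ?_
    have : (1 / d : ℝ) ≤ 1 := by
      rw [div_le_one hd']; exact_mod_cast hd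
    nlinarith [muk_nonneg d k]
  calc muk d k ^ (-(α / 2)) ≤ (∏ j, (2 - 2 * Real.cos (k j)) ^ (1 / d : ℝ)) ^ (-(α / 2)) :=
        Real.rpow_le_rpow_of_nonpos (Finset.prod_pos fun j _ => Real.rpow_pos_of_pos (hz j) _)
          hle (by linarith)
    _ = _ := by
        rw [← Real.finsetProd_rpow _ _ fun j _ => (Real.rpow_pos_of_pos (hz j) _).le]
        refine Finset.prod_congr rfl fun j _ => ?_
        rw [← Real.rpow_mul (hz j).le]
        congr 1
        field_simp

/-- The Fourier phase. -/
def phase {d : ℕ} (n : Z d) (k : Fin d → ℝ) : ℝ := ∑ j, ((n j : ℤ) : ℝ) * k j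

lemma phase_measurable {d : ℕ} (n : Z d) : Measurable (phase n) := by
  unfold phase; fun_prop

lemma integral_cos_phase_nonneg {d : ℕ} (n : Z d) :
    0 ≤ ∫ k in box d, Real.cos (phase n k) := by
  have h1 : ∀ k : Fin d → ℝ, (Real.cos (phase n k)) =
      RCLike.re (∏ j, Complex.exp (Complex.I * (n j) * k j)) := by
    intro k
    rw [← Complex.exp_sum]
    have : ∑ j, Complex.I * (n j) * k j = (phase n k : ℂ) * Complex.I := by
      simp only [phase]
      push_cast
      rw [Finset.sum_mul]
      refine Finset.sum_congr rfl fun j _ => by ring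
    rw [this]
    exact (Complex.exp_ofReal_mul_I_re _).symm
  have hIntg : Integrable (fun k : Fin d → ℝ => ∏ j, Complex.exp (Complex.I * (n j) * k j))
      (volume.restrict (box d)) := by
    rw [box_restrict]
    refine Integrable.fintype_prod (f := fun j k => Complex.exp (Complex.I * (n j) * (k : ℝ)))
      fun j => ?_
    refine (Continuous.integrableOn_Icc (a := 0) (b := 2 * Real.pi) (by fun_prop)).mono_set
      Set.Ioo_subset_Icc_self
  simp_rw [h1]
  rw [integral_re hIntg, box_restrict, integral_fintype_prod_eq_prod
    (f := fun j k => Complex.exp (Complex.I * (n j) * (k : ℝ)))]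
  have h2 : ∀ j, ∃ r : ℝ, 0 ≤ r ∧ ∫ k in Set.Ioo (0 : ℝ) (2 * Real.pi),
      Complex.exp (Complex.I * (n j) * (k : ℝ)) = r := by
    intro j
    rw [← integral_Ioc_eq_integral_Ioo, ← intervalIntegral.integral_of_le (by positivity)]
    by_cases hn : n j = 0
    · refine ⟨2 * Real.pi, by positivity, ?_⟩
      simp [hn]
    · refine ⟨0, le_rfl, ?_⟩
      rw [integral_exp_mul_complex (by simp [hn])]
      have : Complex.exp (Complex.I * (n j) * ((2 * Real.pi : ℝ) : ℂ)) = 1 := by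
        rw [Complex.exp_eq_one_iff]
        exact ⟨n j, by push_cast; ring⟩
      rw [this]; simp
  choose r hr hr' using h2
  simp_rw [hr']
  rw [← Complex.ofReal_prod]
  change 0 ≤ (((∏ j, r j : ℝ) : ℂ)).re
  rw [Complex.ofReal_re]
  exact Finset.prod_nonneg fun j _ => hr j

/-- The symbol of the simple random walk. -/
def sym (d : ℕ) (k : Fin d → ℝ) : ℝ := (1 / d) * ∑ j, Real.cos (k j)

lemma sym_measurable (d : ℕ) : Measurable (sym d) := by
  unfold sym; fun_prop

lemma sym_abs_le {d : ℕ} (hd : 0 < d) (k : Fin d → ℝ) : |sym d k| ≤ 1 := by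
  have hd' : (0 : ℝ) < d := by exact_mod_cast hd
  rw [sym, abs_mul, abs_of_pos (by positivity)]
  have : |∑ j, Real.cos (k j)| ≤ d := by
    refine (Finset.abs_sum_le_sum_abs _ _).trans ?_
    refine (Finset.sum_le_sum fun j _ => Real.abs_cos_le_one (k j)).trans ?_
    simp
  rw [one_div, inv_mul_le_iff₀ hd']; linarith

lemma box_finite (d : ℕ) : IsFiniteMeasure (volume.restrict (box d) : Measure (Fin d → ℝ)) := by
  rw [box_restrict]; infer_instance

lemma cos_sym_integrable {d : ℕ} (hd : 0 < d) (m : ℕ) (n : Z d) :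
    Integrable (fun k => Real.cos (phase n k) * sym d k ^ m) (volume.restrict (box d)) := by
  have := box_finite d
  refine Integrable.of_bound (C := 1) (Measurable.aestronglyMeasurable ?_) ?_
  · exact (Real.measurable_cos.comp (phase_measurable n)).mul ((sym_measurable d).pow_const m)
  · refine Eventually.of_forall fun k => ?_
    rw [norm_mul, norm_pow, Real.norm_eq_abs, Real.norm_eq_abs]
    exact mul_le_one₀ (Real.abs_cos_le_one _) (by positivity)
      (pow_le_one₀ (abs_nonneg _) (sym_abs_le hd k))

lemma integral_cos_sym_nonneg {d : ℕ} (hd : 0 < d) (m : ℕ) : ∀ n : Z d,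
    0 ≤ ∫ k in box d, Real.cos (phase n k) * sym d k ^ m := by
  induction m with
  | zero => intro n; simpa using integral_cos_phase_nonneg n
  | succ m ih =>
    intro n
    have key : ∀ k, Real.cos (phase n k) * sym d k ^ (m + 1) =
        ∑ j, (1 / (2 * d) : ℝ) * (Real.cos (phase (n + Pi.single j 1) k) * sym d k ^ m +
          Real.cos (phase (n - Pi.single j 1) k) * sym d k ^ m) := by
      intro k
      have e1 : ∀ j, phase (n + Pi.single j 1) k = phase n k + k j := by
        intro j
        simp [phase, add_mul, Finset.sum_add_distrib, Pi.single_apply]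
      have e2 : ∀ j, phase (n - Pi.single j 1) k = phase n k - k j := by
        intro j
        simp [phase, sub_mul, Finset.sum_sub_distrib, Pi.single_apply]
      simp_rw [e1, e2, Real.cos_add, Real.cos_sub]
      rw [pow_succ]
      nth_rewrite 2 [sym]
      rw [Finset.mul_sum, Finset.mul_sum, Finset.mul_sum]
      refine Finset.sum_congr rfl fun j _ => ?_
      have hd' : (d : ℝ) ≠ 0 := by exact_mod_cast hd.ne'
      field_simp
      ring
    simp_rw [key]
    rw [integral_finsetSum]
    · refine Finset.sum_nonneg fun j _ => ?_
      rw [integral_const_mul, integral_add (cos_sym_integrable hd m _)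
        (cos_sym_integrable hd m _)]
      exact mul_nonneg (by positivity) (add_nonneg (ih _) (ih _))
    · intro j _
      exact ((cos_sym_integrable hd m _).add (cos_sym_integrable hd m _)).const_mul _

lemma binom_nonneg {a : ℝ} (ha : 0 < a) (n : ℕ) : 0 ≤ Ring.choose (a + n - 1) n := by
  rw [← Ring.multichoose_eq]
  have h := Ring.factorial_nsmul_multichoose_eq_ascPochhammer a n
  rw [Polynomial.ascPochhammer_smeval_eq_eval, nsmul_eq_mul] at h
  have h1 := ascPochhammer_pos n a ha
  rw [← h] at h1
  exact (pos_of_mul_pos_right h1 (by positivity)).le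

lemma integral_resolvent_nonneg {d : ℕ} (hd : 0 < d) {a l : ℝ} (ha : 0 < a) (hl : 0 < l)
    (hl' : l < 1) (n : Z d) :
    0 ≤ ∫ k in box d, Real.cos (phase n k) * (1 - l * sym d k) ^ (-a) := by
  have hfin := box_finite d
  have hps := Real.one_div_one_sub_rpow_hasFPowerSeriesOnBall_zero a
  have hs : ∀ y : ℝ, |y| < 1 → HasSum (fun m : ℕ => Ring.choose (a + m - 1) m * y ^ m)
      ((1 - y) ^ (-a)) := by
    intro y hy
    have := hps.hasSum (y := y) (by simpa [enorm_eq_nnnorm] using! hy)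
    simpa [mul_comm, Real.rpow_neg (by linarith [(abs_lt.1 hy).2] : (0:ℝ) ≤ 1 - y)] using this
  have hll : |l| < 1 := by rwa [abs_of_pos hl]
  have H : HasSum (fun m : ℕ => ∫ k in box d, Real.cos (phase n k) *
      (Ring.choose (a + m - 1) m * (l * sym d k) ^ m))
      (∫ k in box d, Real.cos (phase n k) * (1 - l * sym d k) ^ (-a)) := by
    refine hasSum_integral_of_dominated_convergence
      (fun m _ => Ring.choose (a + m - 1) m * l ^ m) ?_ ?_ ?_ ?_ ?_
    · intro m
      exact ((Real.measurable_cos.comp (phase_measurable n)).mul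
        ((((sym_measurable d).const_mul l).pow_const m).const_mul _)).aestronglyMeasurable
    · intro m
      refine Eventually.of_forall fun k => ?_
      have h0 := binom_nonneg ha m
      rw [norm_mul, norm_mul, norm_pow, norm_mul, Real.norm_of_nonneg h0,
        Real.norm_of_nonneg hl.le, Real.norm_eq_abs, Real.norm_eq_abs]
      have h1 := Real.abs_cos_le_one (phase n k)
      have h2 : (l * |sym d k|) ^ m ≤ l ^ m :=
        pow_le_pow_left₀ (by positivity) (by nlinarith [sym_abs_le hd k]) m
      calc _ ≤ 1 * (Ring.choose (a + m - 1) m * l ^ m) := by gcongr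
        _ = _ := one_mul _
    · exact Eventually.of_forall fun k => (hs l hll).summable
    · exact integrable_const _
    · refine Eventually.of_forall fun k => ?_
      refine (hs (l * sym d k) ?_).mul_left _
      rw [abs_mul, abs_of_pos hl]
      nlinarith [sym_abs_le hd k]
  refine H.nonneg fun m => ?_
  have : ∀ k, Real.cos (phase n k) * (Ring.choose (a + m - 1) m * (l * sym d k) ^ m) =
      (Ring.choose (a + m - 1) m * l ^ m) * (Real.cos (phase n k) * sym d k ^ m) := by
    intro k; rw [mul_pow]; ring
  simp_rw [this]
  rw [integral_const_mul]
  exact mul_nonneg (mul_nonneg (binom_nonneg ha m) (by positivity))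
    (integral_cos_sym_nonneg hd m n)

lemma muk_sym {d : ℕ} (hd : 0 < d) (k : Fin d → ℝ) : muk d k = 2 * d * (1 - sym d k) := by
  have hd' : (d : ℝ) ≠ 0 := by exact_mod_cast hd.ne'
  rw [muk, sym]; field_simp

lemma integral_cos_muk_nonneg {d : ℕ} (hd : 0 < d) {α : ℝ} (hα : α ∈ Set.Ioo (0 : ℝ) (d : ℝ))
    (n : Z d) : 0 ≤ ∫ k in box d, Real.cos (phase n k) * muk d k ^ (-(α / 2)) := by
  have hfin := box_finite d
  have hα0 := hα.1
  have hd' : (0 : ℝ) < d := by exact_mod_cast hd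
  have hmul : ∀ k, muk d k ^ (-(α / 2)) = (2 * d : ℝ) ^ (-(α / 2)) * (1 - sym d k) ^ (-(α / 2)) := by
    intro k
    rw [muk_sym hd, Real.mul_rpow (by positivity)]
    linarith [(abs_le.1 (sym_abs_le hd k)).2]
  have hi : Integrable (fun k => (1 - sym d k) ^ (-(α / 2))) (volume.restrict (box d)) := by
    have := muk_integrable hd hα
    simp_rw [hmul] at this
    rwa [integrable_const_mul_iff] at this
    exact (isUnit_iff_ne_zero.2 (by positivity))
  have lim : Tendsto (fun m : ℕ => ∫ k in box d, Real.cos (phase n k) *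
      (1 - (1 - 1 / ((m : ℝ) + 2)) * sym d k) ^ (-(α / 2))) atTop
      (𝓝 (∫ k in box d, Real.cos (phase n k) * (1 - sym d k) ^ (-(α / 2)))) := by
    have hlim : Tendsto (fun m : ℕ => 1 - 1 / ((m : ℝ) + 2)) atTop (𝓝 1) := by
      have : Tendsto (fun m : ℕ => 1 / ((m : ℝ) + 2)) atTop (𝓝 0) := by
        refine Tendsto.div_atTop tendsto_const_nhds ?_
        exact tendsto_atTop_add_const_right _ _ tendsto_natCast_atTop_atTop
      simpa using this.const_sub 1
    refine tendsto_integral_of_dominated_convergence (fun k => (1 - sym d k) ^ (-(α / 2)) + 1)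
      ?_ (hi.add (integrable_const _)) ?_ ?_
    · intro m
      exact ((Real.measurable_cos.comp (phase_measurable n)).mul
        ((((sym_measurable d).const_mul _).const_sub _).pow_const _)).aestronglyMeasurable
    · intro m
      filter_upwards [box_ae d] with k hk
      have hs : 0 < 1 - sym d k := by
        have : 0 < muk d k := by
          rw [muk_eq]
          have : Nonempty (Fin d) := ⟨⟨0, hd⟩⟩
          exact Finset.sum_pos (fun j _ => zcos_pos (hk j)) Finset.univ_nonempty
        rw [muk_sym hd] at this
        exact pos_of_mul_pos_right this (by positivity)
      have hm : 0 < 1 / ((m : ℝ) + 2) := by positivity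
      have hm1 : 1 / ((m : ℝ) + 2) < 1 := by
        rw [div_lt_one (by positivity)]; linarith [Nat.cast_nonneg (α := ℝ) m]
      set e := 1 / ((m : ℝ) + 2)
      have hpos : 0 ≤ 1 - (1 - e) * sym d k := by nlinarith
      rw [norm_mul, Real.norm_eq_abs, Real.norm_of_nonneg (Real.rpow_nonneg hpos _)]
      have hb : (1 - (1 - e) * sym d k) ^ (-(α / 2)) ≤ (1 - sym d k) ^ (-(α / 2)) + 1 := by
        rcases le_total 0 (sym d k) with h0 | h0
        · have := Real.rpow_le_rpow_of_nonpos hs (show 1 - sym d k ≤ 1 - (1 - e) * sym d k by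
            nlinarith) (show -(α / 2) ≤ 0 by linarith)
          linarith
        · have := Real.rpow_le_one_of_one_le_of_nonpos (show 1 ≤ 1 - (1 - e) * sym d k by
            nlinarith) (show -(α / 2) ≤ 0 by linarith)
          have := Real.rpow_nonneg hs.le (-(α / 2))
          linarith
      calc _ ≤ 1 * (1 - (1 - e) * sym d k) ^ (-(α / 2)) := by
            gcongr
            exact Real.abs_cos_le_one _
        _ ≤ _ := by rw [one_mul]; exact hb
    · filter_upwards [box_ae d] with k hk
      have hs : 0 < 1 - sym d k := by
        have : 0 < muk d k := by
          rw [muk_eq]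
          have : Nonempty (Fin d) := ⟨⟨0, hd⟩⟩
          exact Finset.sum_pos (fun j _ => zcos_pos (hk j)) Finset.univ_nonempty
        rw [muk_sym hd] at this
        exact pos_of_mul_pos_right this (by positivity)
      refine Tendsto.const_mul _ ?_
      refine Tendsto.rpow_const ?_ (Or.inl hs.ne')
      simpa using (hlim.mul_const (sym d k)).const_sub 1
  have hge := ge_of_tendsto' lim fun m => by
    have hm : 0 < 1 / ((m : ℝ) + 2) := by positivity
    have hm1 : 1 / ((m : ℝ) + 2) < 1 := by
      rw [div_lt_one (by positivity)]; linarith [Nat.cast_nonneg (α := ℝ) m]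
    exact integral_resolvent_nonneg hd (a := α / 2) (l := 1 - 1 / ((m : ℝ) + 2)) (by positivity)
      (by linarith) (by linarith) n
  have : ∀ k, Real.cos (phase n k) * muk d k ^ (-(α / 2)) =
      (2 * d : ℝ) ^ (-(α / 2)) * (Real.cos (phase n k) * (1 - sym d k) ^ (-(α / 2))) := by
    intro k; rw [hmul]; ring
  simp_rw [this]
  rw [integral_const_mul]
  exact mul_nonneg (by positivity) hge

lemma Kfrac_nonneg (d : ℕ) (α : ℝ) : 0 ≤ Kfrac d α := by
  unfold Kfrac
  refine mul_nonneg (by positivity) (integral_nonneg fun k => ?_)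
  exact Real.rpow_nonneg (muk_nonneg d k) _

lemma Riesz_eq (d : ℕ) (α : ℝ) (x y : Z d) : Riesz d α x y =
    Kfrac d α * (2 * Real.pi) ^ (-(d : ℝ)) *
    ∫ k in box d, Real.cos (phase (x - y) k) * muk d k ^ (-(α / 2)) := rfl

lemma Riesz_nonneg {d : ℕ} (hd : 0 < d) {α : ℝ} (hα : α ∈ Set.Ioo (0 : ℝ) (d : ℝ))
    (x y : Z d) : 0 ≤ Riesz d α x y := by
  rw [Riesz_eq]
  exact mul_nonneg (mul_nonneg (Kfrac_nonneg d α) (by positivity))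
    (integral_cos_muk_nonneg hd hα _)

lemma Riesz_symm (d : ℕ) (α : ℝ) (x y : Z d) : Riesz d α x y = Riesz d α y x := by
  rw [Riesz_eq, Riesz_eq]
  have : ∀ k, Real.cos (phase (x - y) k) = Real.cos (phase (y - x) k) := by
    intro k
    rw [← Real.cos_neg]
    congr 1
    simp [phase, sub_mul]
  simp_rw [this]

lemma Riesz_bdd {d : ℕ} (hd : 0 < d) {α : ℝ} (hα : α ∈ Set.Ioo (0 : ℝ) (d : ℝ)) :
    ∃ B : ℝ, 0 < B ∧ ∀ x y : Z d, Riesz d α x y ≤ B := by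
  have hK : 0 ≤ Kfrac d α * (2 * Real.pi) ^ (-(d : ℝ)) :=
    mul_nonneg (Kfrac_nonneg d α) (by positivity)
  refine ⟨Kfrac d α * (2 * Real.pi) ^ (-(d : ℝ)) * (∫ k in box d, muk d k ^ (-(α / 2))) + 1,
    ?_, fun x y => ?_⟩
  · have : 0 ≤ ∫ k in box d, muk d k ^ (-(α / 2)) :=
      integral_nonneg fun k => Real.rpow_nonneg (muk_nonneg d k) _
    have := mul_nonneg hK this
    linarith
  · rw [Riesz_eq]
    refine le_trans (mul_le_mul_of_nonneg_left ?_ hK) (by linarith)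
    have hm := muk_integrable hd hα
    refine integral_mono (hm.mono' ?_ ?_) hm ?_
    · exact ((Real.measurable_cos.comp (phase_measurable _)).mul
        ((muk_measurable d).pow_const _)).aestronglyMeasurable
    · refine Eventually.of_forall fun k => ?_
      have h1 := Real.rpow_nonneg (muk_nonneg d k) (-(α / 2))
      rw [norm_mul, Real.norm_eq_abs, Real.norm_of_nonneg h1]
      exact mul_le_of_le_one_left h1 (Real.abs_cos_le_one _)
    · intro k
      exact mul_le_of_le_one_left (Real.rpow_nonneg (muk_nonneg d k) _) (Real.cos_le_one _)

/-! ### Summation lemmas -/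

lemma tail_bound {ι : Type*} {w c : ι → ℝ} {B M : ℝ} (hM : 0 < M) (hw : ∀ x, 0 ≤ w x)
    (hc : ∀ x, 0 ≤ c x) (sc : Summable c) (swc : Summable fun x => w x * c x)
    (hB : ∑' x, w x * c x ≤ B) (S : Finset ι) (hS : ∀ x, x ∉ S → M ≤ w x) :
    |∑' x, c x - ∑ x ∈ S, c x| ≤ B / M := by
  have h1 := sc.sum_add_tsum_subtype_compl S
  have h2 : ∑' x, c x - ∑ x ∈ S, c x = ∑' x : {x // x ∉ S}, c x := by linarith
  rw [h2, abs_of_nonneg (tsum_nonneg fun x : {x // x ∉ S} => hc x), le_div_iff₀ hM, ← tsum_mul_right]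
  refine le_trans ?_ hB
  refine le_trans (Summable.tsum_le_tsum (g := fun x : {x // x ∉ S} => w x * c x) ?_
    ((sc.subtype _).mul_right M) (swc.subtype _)) ?_
  · intro x
    rw [mul_comm]
    exact mul_le_mul_of_nonneg_right (hS x x.2) (hc x)
  · exact Summable.tsum_subtype_le (fun x => w x * c x) {x | x ∉ S}
      (fun x => mul_nonneg (hw x) (hc x)) swc

lemma tendsto_tsum_of_weight {ι β : Type*} {l : Filter β} {w : ι → ℝ}
    (hw : ∀ x, 0 ≤ w x) (hwt : Tendsto w cofinite atTop)
    {c : β → ι → ℝ} {c0 : ι → ℝ} {B : ℝ}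
    (hc : ∀ᶠ n in l, (∀ x, 0 ≤ c n x) ∧ Summable (c n) ∧ (Summable fun x => w x * c n x) ∧
      ∑' x, w x * c n x ≤ B)
    (hc0 : (∀ x, 0 ≤ c0 x) ∧ Summable c0 ∧ (Summable fun x => w x * c0 x) ∧
      ∑' x, w x * c0 x ≤ B)
    (hpt : ∀ x, Tendsto (fun n => c n x) l (𝓝 (c0 x))) :
    Tendsto (fun n => ∑' x, c n x) l (𝓝 (∑' x, c0 x)) := by
  have hB : 0 ≤ B := le_trans (tsum_nonneg fun x => mul_nonneg (hw x) (hc0.1 x)) hc0.2.2.2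
  rw [Metric.tendsto_nhds]
  intro ε hε
  set M : ℝ := 3 * (B + 1) / ε with hMdef
  have hM : 0 < M := by positivity
  have hBM : B / M < ε / 3 := by
    rw [hMdef, div_div_eq_mul_div, div_lt_iff₀ (by positivity)]
    nlinarith
  have hfin : {x | ¬ M ≤ w x}.Finite := by
    have := hwt.eventually (eventually_ge_atTop M)
    exact this
  let S := hfin.toFinset
  have hS : ∀ x, x ∉ S → M ≤ w x := by
    intro x hx
    by_contra h
    exact hx (by simpa [S] using h)
  have hsum : Tendsto (fun n => ∑ x ∈ S, c n x) l (𝓝 (∑ x ∈ S, c0 x)) :=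
    tendsto_finsetSum _ fun x _ => hpt x
  rw [Metric.tendsto_nhds] at hsum
  filter_upwards [hc, hsum (ε / 3) (by positivity)] with n hn hn2
  have t1 := tail_bound hM hw hn.1 hn.2.1 hn.2.2.1 hn.2.2.2 S hS
  have t2 := tail_bound hM hw hc0.1 hc0.2.1 hc0.2.2.1 hc0.2.2.2 S hS
  rw [Real.dist_eq] at hn2 ⊢
  rw [abs_lt] at hn2 ⊢
  rw [abs_le] at t1 t2
  constructor <;> linarith [hn2.1, hn2.2, t1.1, t1.2, t2.1, t2.2]

/-- The double-sum functional. -/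
def Phi (d : ℕ) (α : ℝ) (a b : ℝ → ℝ) (u : Z d → ℝ) : ℝ :=
  ∑' z : Z d × Z d, Riesz d α z.1 z.2 * (b (u z.1) * a (u z.2))

/-- Admissible nonlinearities. -/
def Nice (p : ℝ) (a : ℝ → ℝ) : Prop :=
  Continuous a ∧ (∀ t, 0 ≤ a t) ∧ ∀ L : ℝ, ∃ C : ℝ, 0 ≤ C ∧ ∀ t, |t| ≤ L → a t ≤ C * |t| ^ p

section memH
variable {d : ℕ} {W : Z d → Z d → ℝ} {h : Z d → ℝ} {p h₀ : ℝ} {u : Z d → ℝ}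

lemma gradNorm_nonneg (x : Z d) : 0 ≤ gradNorm W u x := Real.sqrt_nonneg _

lemma term_nonneg (hh₀ : 0 < h₀) (hh1 : ∀ x, h₀ ≤ h x) (x : Z d) :
    0 ≤ h x * |u x| ^ p :=
  mul_nonneg (hh₀.le.trans (hh1 x)) (Real.rpow_nonneg (abs_nonneg _) _)

lemma grad_nonneg (x : Z d) : 0 ≤ gradNorm W u x ^ p := Real.rpow_nonneg (gradNorm_nonneg x) _

lemma HnormP_nonneg (hh₀ : 0 < h₀) (hh1 : ∀ x, h₀ ≤ h x) : 0 ≤ HnormP W h p u :=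
  tsum_nonneg fun x => add_nonneg (grad_nonneg x) (term_nonneg hh₀ hh1 x)

lemma memH_h (hh₀ : 0 < h₀) (hh1 : ∀ x, h₀ ≤ h x) (hu : memH W h p u) :
    (Summable fun x => h x * |u x| ^ p) ∧ ∑' x, h x * |u x| ^ p ≤ HnormP W h p u := by
  have hs : Summable fun x => h x * |u x| ^ p :=
    Summable.of_nonneg_of_le (fun x => term_nonneg hh₀ hh1 x)
      (fun x => le_add_of_nonneg_left (grad_nonneg x)) hu.2
  exact ⟨hs, Summable.tsum_le_tsum (fun x => le_add_of_nonneg_left (grad_nonneg x)) hs hu.2⟩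

lemma memH_p (hh₀ : 0 < h₀) (hh1 : ∀ x, h₀ ≤ h x) (hu : memH W h p u) :
    (Summable fun x => |u x| ^ p) ∧ ∑' x, |u x| ^ p ≤ HnormP W h p u / h₀ := by
  obtain ⟨h1, h2⟩ := memH_h hh₀ hh1 hu
  have hle : ∀ x, |u x| ^ p ≤ h x * |u x| ^ p / h₀ := by
    intro x
    rw [le_div_iff₀ hh₀, mul_comm]
    exact mul_le_mul_of_nonneg_right (hh1 x) (Real.rpow_nonneg (abs_nonneg _) _)
  have hs : Summable fun x => |u x| ^ p :=
    Summable.of_nonneg_of_le (fun x => Real.rpow_nonneg (abs_nonneg _) _) hle (h1.div_const _)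
  refine ⟨hs, (Summable.tsum_le_tsum hle hs (h1.div_const _)).trans ?_⟩
  rw [tsum_div_const]
  gcongr

lemma memH_sup (hp : 0 < p) (hh₀ : 0 < h₀) (hh1 : ∀ x, h₀ ≤ h x) (hu : memH W h p u) {B : ℝ}
    (hB : HnormP W h p u ≤ B) (x : Z d) : |u x| ≤ (B / h₀) ^ (1 / p) := by
  obtain ⟨h1, h2⟩ := memH_p hh₀ hh1 hu
  have h3 : |u x| ^ p ≤ B / h₀ :=
    (h1.le_tsum x fun y _ => Real.rpow_nonneg (abs_nonneg _) _).trans (h2.trans (by gcongr))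
  calc |u x| = (|u x| ^ p) ^ (1 / p) := by
        rw [← Real.rpow_mul (abs_nonneg _), mul_one_div_cancel hp.ne', Real.rpow_one]
    _ ≤ _ := by gcongr

lemma HnormP_pos (hp : 0 < p) (hh₀ : 0 < h₀) (hh1 : ∀ x, h₀ ≤ h x) (hu : memH W h p u)
    (hu0 : u ≠ 0) : 0 < HnormP W h p u := by
  by_contra hneg
  apply hu0
  funext x
  have := memH_sup hp hh₀ hh1 hu (not_lt.1 hneg) x
  rw [zero_div, Real.zero_rpow (by positivity)] at this
  simpa using this

lemma gradNorm_smul {t : ℝ} (ht : 0 < t) (x : Z d) :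
    gradNorm W (fun x => t * u x) x = t * gradNorm W u x := by
  unfold gradNorm
  have : ∀ y, W x y * (t * u x - t * u y) ^ 2 = t ^ 2 * (W x y * (u x - u y) ^ 2) := by
    intro y; ring
  simp_rw [this]
  rw [tsum_mul_left, ← mul_assoc, mul_comm (1 / 2 : ℝ), mul_assoc, Real.sqrt_mul (by positivity),
    Real.sqrt_sq ht.le]

lemma term_smul {t : ℝ} (ht : 0 < t) (x : Z d) :
    gradNorm W (fun x => t * u x) x ^ p + h x * |t * u x| ^ p =
      t ^ p * (gradNorm W u x ^ p + h x * |u x| ^ p) := by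
  rw [gradNorm_smul ht, Real.mul_rpow ht.le (gradNorm_nonneg x), abs_mul, abs_of_pos ht,
    Real.mul_rpow ht.le (abs_nonneg _)]
  ring

lemma HnormP_smul {t : ℝ} (ht : 0 < t) :
    HnormP W h p (fun x => t * u x) = t ^ p * HnormP W h p u := by
  unfold HnormP
  simp_rw [term_smul ht]
  rw [tsum_mul_left]

lemma memH_smul {t : ℝ} (ht : 0 < t) (hu : memH W h p u) : memH W h p (fun x => t * u x) := by
  refine ⟨fun x => ?_, ?_⟩
  · have : ∀ y, W x y * (t * u x - t * u y) ^ 2 = t ^ 2 * (W x y * (u x - u y) ^ 2) := by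
      intro y; ring
    simp_rw [this]
    exact (hu.1 x).mul_left _
  · simp_rw [term_smul ht]
    exact hu.2.mul_left _

end memH

section Phi
variable {d : ℕ} {W : Z d → Z d → ℝ} {h : Z d → ℝ} {p h₀ α : ℝ} {a b : ℝ → ℝ}

/-- Uniform constants for bounded sets of `H`. -/
lemma nice_bound (hp : 0 < p) (hh₀ : 0 < h₀) (hh1 : ∀ x, h₀ ≤ h x) (ha : Nice p a) (B : ℝ) :
    ∃ C : ℝ, 0 ≤ C ∧ ∀ u, memH W h p u → HnormP W h p u ≤ B → ∀ x, a (u x) ≤ C * |u x| ^ p := by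
  obtain ⟨C, hC, hC'⟩ := ha.2.2 ((B / h₀) ^ (1 / p))
  exact ⟨C, hC, fun u hu hB x => hC' _ (memH_sup hp hh₀ hh1 hu hB x)⟩

lemma pair_summable (hd : 0 < d) (hα : α ∈ Set.Ioo (0 : ℝ) (d : ℝ)) {A B : Z d → ℝ}
    (hA : ∀ x, 0 ≤ A x) (hB : ∀ x, 0 ≤ B x) (sA : Summable A) (sB : Summable B) :
    Summable fun z : Z d × Z d => Riesz d α z.1 z.2 * (B z.1 * A z.2) := by
  obtain ⟨K, hK, hK'⟩ := Riesz_bdd hd hα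
  refine Summable.of_nonneg_of_le (fun z => mul_nonneg (Riesz_nonneg hd hα _ _)
    (mul_nonneg (hB _) (hA _))) (fun z => mul_le_mul_of_nonneg_right (hK' _ _)
    (mul_nonneg (hB _) (hA _))) ?_
  exact (sB.mul_of_nonneg sA hB hA).mul_left K

lemma conv_sum_eq (hd : 0 < d) (hα : α ∈ Set.Ioo (0 : ℝ) (d : ℝ)) {A B : Z d → ℝ}
    (hA : ∀ x, 0 ≤ A x) (hB : ∀ x, 0 ≤ B x) (sA : Summable A) (sB : Summable B) :
    ∑' x, conv d α A x * B x = ∑' z : Z d × Z d, Riesz d α z.1 z.2 * (B z.1 * A z.2) := by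
  rw [(pair_summable hd hα hA hB sA sB).tsum_prod]
  refine tsum_congr fun x => ?_
  unfold conv
  rw [← tsum_mul_right]
  refine tsum_congr fun y => ?_
  ring

lemma nice_summable (hp : 0 < p) (hh₀ : 0 < h₀) (hh1 : ∀ x, h₀ ≤ h x) (ha : Nice p a)
    {u : Z d → ℝ} (hu : memH W h p u) : Summable fun x => a (u x) := by
  obtain ⟨C, hC, hC'⟩ := nice_bound (W := W) hp hh₀ hh1 ha (HnormP W h p u)
  exact Summable.of_nonneg_of_le (fun x => ha.2.1 _) (hC' u hu le_rfl)
    ((memH_p hh₀ hh1 hu).1.mul_left C)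

lemma Phi_summable (hd : 0 < d) (hα : α ∈ Set.Ioo (0 : ℝ) (d : ℝ))
    (hp : 0 < p) (hh₀ : 0 < h₀) (hh1 : ∀ x, h₀ ≤ h x) (ha : Nice p a) (hb : Nice p b)
    {u : Z d → ℝ} (hu : memH W h p u) :
    Summable fun z : Z d × Z d => Riesz d α z.1 z.2 * (b (u z.1) * a (u z.2)) :=
  pair_summable hd hα (fun _ => ha.2.1 _) (fun _ => hb.2.1 _)
    (nice_summable hp hh₀ hh1 ha hu) (nice_summable hp hh₀ hh1 hb hu)

lemma Phi_nonneg (hd : 0 < d) (hα : α ∈ Set.Ioo (0 : ℝ) (d : ℝ)) (ha : Nice p a) (hb : Nice p b)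
    (u : Z d → ℝ) : 0 ≤ Phi d α a b u :=
  tsum_nonneg fun _ => mul_nonneg (Riesz_nonneg hd hα _ _) (mul_nonneg (hb.2.1 _) (ha.2.1 _))

lemma Phi_bound (hd : 0 < d) (hα : α ∈ Set.Ioo (0 : ℝ) (d : ℝ))
    (hp : 0 < p) (hh₀ : 0 < h₀) (hh1 : ∀ x, h₀ ≤ h x) (ha : Nice p a) (hb : Nice p b) (B : ℝ) :
    ∃ K : ℝ, 0 ≤ K ∧ ∀ u : Z d → ℝ, memH W h p u → HnormP W h p u ≤ B →
      Phi d α a b u ≤ K * HnormP W h p u ^ 2 := by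
  obtain ⟨K, hK, hK'⟩ := Riesz_bdd hd hα
  obtain ⟨C1, hC1, hC1'⟩ := nice_bound (W := W) hp hh₀ hh1 ha B
  obtain ⟨C2, hC2, hC2'⟩ := nice_bound (W := W) hp hh₀ hh1 hb B
  refine ⟨K * (C2 * C1) / h₀ ^ 2, by positivity, fun u hu huB => ?_⟩
  obtain ⟨s1, s2⟩ := memH_p hh₀ hh1 hu
  have hn : ∀ x, 0 ≤ |u x| ^ p := fun x => Real.rpow_nonneg (abs_nonneg _) _
  have sp := s1.mul_of_nonneg s1 hn hn
  calc Phi d α a b u ≤ ∑' z : Z d × Z d, K * (C2 * C1) * (|u z.1| ^ p * |u z.2| ^ p) := by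
        refine Summable.tsum_le_tsum (fun z => ?_) (Phi_summable hd hα hp hh₀ hh1 ha hb hu)
          (sp.mul_left _)
        calc _ ≤ K * ((C2 * |u z.1| ^ p) * (C1 * |u z.2| ^ p)) := by
              refine mul_le_mul (hK' _ _) ?_ (mul_nonneg (hb.2.1 _) (ha.2.1 _)) hK.le
              exact mul_le_mul (hC2' u hu huB _) (hC1' u hu huB _) (ha.2.1 _)
                (mul_nonneg hC2 (hn _))
          _ = _ := by ring
    _ = K * (C2 * C1) * ((∑' x, |u x| ^ p) * (∑' x, |u x| ^ p)) := by
        rw [tsum_mul_left, s1.tsum_mul_tsum s1 sp]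
    _ ≤ K * (C2 * C1) * ((HnormP W h p u / h₀) * (HnormP W h p u / h₀)) := by
        have : 0 ≤ ∑' x, |u x| ^ p := tsum_nonneg hn
        have h0' : 0 ≤ HnormP W h p u / h₀ := this.trans s2
        gcongr
    _ = _ := by field_simp

lemma Phi_tendsto (hd : 0 < d) (hα : α ∈ Set.Ioo (0 : ℝ) (d : ℝ))
    (hp : 0 < p) (hh₀ : 0 < h₀) (hh1 : ∀ x, h₀ ≤ h x) (hh2 : H2 h)
    (ha : Nice p a) (hb : Nice p b) {B : ℝ} {β : Type*} {l : Filter β}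
    {U : β → Z d → ℝ} {u : Z d → ℝ}
    (hU : ∀ᶠ n in l, memH W h p (U n) ∧ HnormP W h p (U n) ≤ B)
    (hu : memH W h p u) (huB : HnormP W h p u ≤ B)
    (hpt : ∀ x, Tendsto (fun n => U n x) l (𝓝 (u x))) :
    Tendsto (fun n => Phi d α a b (U n)) l (𝓝 (Phi d α a b u)) := by
  obtain ⟨K, hK, hK'⟩ := Riesz_bdd hd hα
  obtain ⟨C1, hC1, hC1'⟩ := nice_bound (W := W) hp hh₀ hh1 ha B
  obtain ⟨C2, hC2, hC2'⟩ := nice_bound (W := W) hp hh₀ hh1 hb B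
  have hh0 : ∀ x, 0 ≤ h x := fun x => hh₀.le.trans (hh1 x)
  have key : ∀ v : Z d → ℝ, memH W h p v ∧ HnormP W h p v ≤ B →
      (∀ z : Z d × Z d, 0 ≤ Riesz d α z.1 z.2 * (b (v z.1) * a (v z.2))) ∧
      (Summable fun z : Z d × Z d => Riesz d α z.1 z.2 * (b (v z.1) * a (v z.2))) ∧
      (Summable fun z : Z d × Z d =>
        (h z.1 + h z.2) * (Riesz d α z.1 z.2 * (b (v z.1) * a (v z.2)))) ∧
      ∑' z : Z d × Z d, (h z.1 + h z.2) * (Riesz d α z.1 z.2 * (b (v z.1) * a (v z.2))) ≤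
        K * (C2 * C1) * (B * (B / h₀) + (B / h₀) * B) := by
    rintro v ⟨hv, hvB⟩
    have hB : 0 ≤ B := (HnormP_nonneg hh₀ hh1).trans hvB
    have hn : ∀ x, 0 ≤ |v x| ^ p := fun x => Real.rpow_nonneg (abs_nonneg _) _
    have hn' : ∀ x, 0 ≤ h x * |v x| ^ p := fun x => mul_nonneg (hh0 x) (hn x)
    obtain ⟨s1, s2⟩ := memH_p hh₀ hh1 hv
    obtain ⟨s3, s4⟩ := memH_h hh₀ hh1 hv
    have sp1 := s3.mul_of_nonneg s1 hn' hn
    have sp2 := s1.mul_of_nonneg s3 hn hn'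
    have hnn : ∀ z : Z d × Z d, 0 ≤ Riesz d α z.1 z.2 * (b (v z.1) * a (v z.2)) := fun z =>
      mul_nonneg (Riesz_nonneg hd hα _ _) (mul_nonneg (hb.2.1 _) (ha.2.1 _))
    have hle : ∀ z : Z d × Z d, (h z.1 + h z.2) * (Riesz d α z.1 z.2 * (b (v z.1) * a (v z.2))) ≤
        K * (C2 * C1) * (h z.1 * |v z.1| ^ p * |v z.2| ^ p +
          |v z.1| ^ p * (h z.2 * |v z.2| ^ p)) := by
      intro z
      calc _ ≤ (h z.1 + h z.2) * (K * ((C2 * |v z.1| ^ p) * (C1 * |v z.2| ^ p))) := by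
            refine mul_le_mul_of_nonneg_left ?_ (add_nonneg (hh0 _) (hh0 _))
            refine mul_le_mul (hK' _ _) ?_ (mul_nonneg (hb.2.1 _) (ha.2.1 _)) hK.le
            exact mul_le_mul (hC2' v hv hvB _) (hC1' v hv hvB _) (ha.2.1 _)
                (mul_nonneg hC2 (hn _))
        _ = _ := by ring
    have sS := (sp1.add sp2).mul_left (K * (C2 * C1))
    have sW := Summable.of_nonneg_of_le
      (fun z => mul_nonneg (add_nonneg (hh0 _) (hh0 _)) (hnn z)) hle sS
    refine ⟨hnn, Phi_summable hd hα hp hh₀ hh1 ha hb hv, sW, ?_⟩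
    refine (Summable.tsum_le_tsum hle sW sS).trans ?_
    rw [tsum_mul_left, sp1.tsum_add sp2, ← s3.tsum_mul_tsum s1 sp1, ← s1.tsum_mul_tsum s3 sp2]
    have e1 : 0 ≤ ∑' x, |v x| ^ p := tsum_nonneg hn
    have e2 : 0 ≤ ∑' x, h x * |v x| ^ p := tsum_nonneg hn'
    have s2' : ∑' x, |v x| ^ p ≤ B / h₀ := s2.trans (by gcongr)
    have s4' := s4.trans hvB
    have : 0 ≤ K * (C2 * C1) := by positivity
    gcongr
  have hwt : Tendsto (fun z : Z d × Z d => h z.1 + h z.2) cofinite atTop := by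
    rw [tendsto_atTop]
    intro M
    have hf : {x | ¬ M ≤ h x}.Finite := hh2.eventually (eventually_ge_atTop M)
    refine (hf.prod hf).subset ?_
    intro z hz
    simp only [Set.mem_compl_iff, Set.mem_ofPred_eq, not_le, Set.mem_prod] at hz ⊢
    constructor <;> linarith [hh0 z.1, hh0 z.2]
  refine tendsto_tsum_of_weight (w := fun z : Z d × Z d => h z.1 + h z.2)
    (fun z => add_nonneg (hh0 _) (hh0 _)) hwt (hU.mono fun n hn => key _ hn) (key u ⟨hu, huB⟩) ?_
  intro z
  refine Tendsto.const_mul _ (Tendsto.mul ?_ ?_)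
  · exact (hb.1.tendsto _).comp (hpt _)
  · exact (ha.1.tendsto _).comp (hpt _)

end Phi

/-- The standing assumptions. -/
structure Setup (d : ℕ) (p α h₀ θ : ℝ) (W : Z d → Z d → ℝ) (h : Z d → ℝ) (f : ℝ → ℝ) : Prop where
  hd : 0 < d
  hp : 2 ≤ p
  hα : α ∈ Set.Ioo (0 : ℝ) (d : ℝ)
  hW : ∀ x y, 0 < W x y
  hh₀ : 0 < h₀
  hh1 : ∀ x, h₀ ≤ h x
  hh2 : H2 h
  hfc : Continuous f
  hfz : ∀ t ≤ (0 : ℝ), f t = 0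
  hf1 : F1 f p
  hθ : p < θ
  hf3 : F3 f θ
  hf4 : F4 W h p α f

namespace Setup
variable {d : ℕ} {p α h₀ θ : ℝ} {W : Z d → Z d → ℝ} {h : Z d → ℝ} {f : ℝ → ℝ}

lemma hp0 (S : Setup d p α h₀ θ W h f) : 0 < p := by linarith [S.hp]

lemma hθ0 (S : Setup d p α h₀ θ W h f) : 0 < θ := by linarith [S.hp, S.hθ]

lemma f_nonneg (S : Setup d p α h₀ θ W h f) (t : ℝ) : 0 ≤ f t := by
  rcases le_or_gt t 0 with ht | ht
  · exact (S.hfz t ht).ge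
  · obtain ⟨h1, h2⟩ := S.hf3 t ht
    by_contra hneg
    push Not at hneg
    nlinarith [mul_neg_of_neg_of_pos hneg ht]

lemma F_zero (S : Setup d p α h₀ θ W h f) {t : ℝ} (ht : t ≤ 0) : Fint f t = 0 := by
  unfold Fint
  rw [intervalIntegral.integral_congr (g := fun _ => (0 : ℝ))]
  · simp
  · intro x hx
    rw [Set.uIcc_of_ge ht] at hx
    exact S.hfz x hx.2

lemma F_deriv (S : Setup d p α h₀ θ W h f) (t : ℝ) : HasDerivAt (Fint f) (f t) t :=
  (S.hfc.integral_hasStrictDerivAt 0 t).hasDerivAt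

lemma F_cont (S : Setup d p α h₀ θ W h f) : Continuous (Fint f) :=
  continuous_iff_continuousAt.2 fun t => (S.F_deriv t).continuousAt

lemma F_nonneg (S : Setup d p α h₀ θ W h f) (t : ℝ) : 0 ≤ Fint f t := by
  rcases le_or_gt t 0 with ht | ht
  · exact (S.F_zero ht).ge
  · exact nonneg_of_mul_nonneg_right (S.hf3 t ht).1 S.hθ0

lemma AR (S : Setup d p α h₀ θ W h f) (t : ℝ) : θ * Fint f t ≤ 2 * (f t * t) := by
  rcases le_or_gt t 0 with ht | ht
  · rw [S.F_zero ht, S.hfz t ht]; simp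
  · have := (S.hf3 t ht).2
    linarith

lemma b_nonneg (S : Setup d p α h₀ θ W h f) (t : ℝ) : 0 ≤ f t * t := by
  rcases le_or_gt t 0 with ht | ht
  · rw [S.hfz t ht]; simp
  · exact mul_nonneg (S.f_nonneg t) ht.le

lemma b_nice (S : Setup d p α h₀ θ W h f) : Nice p (fun t => f t * t) := by
  have hc : Continuous fun t => f t * t := S.hfc.mul continuous_id
  refine ⟨hc, S.b_nonneg, fun L => ?_⟩
  obtain ⟨δ, hδ, hδ'⟩ := S.hf1 1 one_pos
  obtain ⟨M, hM⟩ := (isCompact_Icc (a := δ) (b := L)).bddAbove_image hc.continuousOn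
  have hδp : 0 < δ ^ p := Real.rpow_pos_of_pos hδ _
  refine ⟨1 + |M| / δ ^ p, by positivity, fun t ht => ?_⟩
  have hn : 0 ≤ |t| ^ p := Real.rpow_nonneg (abs_nonneg _) _
  rcases le_or_gt t 0 with ht0 | ht0
  · simp only [S.hfz t ht0, zero_mul]; positivity
  rcases lt_or_ge t δ with htd | htd
  · have h1 := hδ' t ht0 htd
    rw [one_mul] at h1
    have h2 : f t * t ≤ |t| ^ p := by
      calc f t * t ≤ t ^ (p - 1) * t := by
            gcongr; exact (le_abs_self _).trans h1
        _ = |t| ^ p := by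
            rw [abs_of_pos ht0]
            nth_rw 2 [← Real.rpow_one t]
            rw [← Real.rpow_add ht0]; simp
    have h3 : 0 ≤ |M| / δ ^ p := by positivity
    nlinarith
  · have h1 : f t * t ≤ |M| := by
      refine (hM ⟨t, ⟨htd, (le_abs_self t).trans ht⟩, rfl⟩).trans (le_abs_self _)
    have h2 : δ ^ p ≤ |t| ^ p := by
      rw [abs_of_pos ht0]
      exact Real.rpow_le_rpow hδ.le htd S.hp0.le
    have h3 : |M| ≤ |M| / δ ^ p * |t| ^ p := by
      rw [div_mul_eq_mul_div, le_div_iff₀ hδp]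
      exact mul_le_mul_of_nonneg_left h2 (abs_nonneg _)
    simp only
    linarith

lemma F_nice (S : Setup d p α h₀ θ W h f) : Nice p (Fint f) := by
  refine ⟨S.F_cont, S.F_nonneg, fun L => ?_⟩
  obtain ⟨C, hC, hC'⟩ := S.b_nice.2.2 L
  have := S.hθ0
  refine ⟨2 / θ * C, by positivity, fun t ht => ?_⟩
  have h1 := hC' t ht
  have h2 := S.AR t
  simp only at h1
  rw [mul_assoc, div_mul_eq_mul_div, le_div_iff₀ this]
  linarith

lemma F_pos (S : Setup d p α h₀ θ W h f) {r : ℝ} (hr : 0 < f r) : 0 < Fint f r := by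
  rcases (S.F_nonneg r).lt_or_eq with h1 | h1
  · exact h1
  · exfalso
    have : IsLocalMin (Fint f) r := by
      refine Filter.Eventually.of_forall fun x => ?_
      rw [← h1]; exact S.F_nonneg x
    have := this.hasDerivAt_eq_zero (S.F_deriv r)
    linarith

lemma F_comp_deriv (S : Setup d p α h₀ θ W h f) (r t : ℝ) :
    HasDerivAt (fun t => Fint f (t * r)) (f (t * r) * r) t := by
  have h1 : HasDerivAt (fun t : ℝ => t * r) r t := by
    simpa using (hasDerivAt_id t).mul_const r
  exact (S.F_deriv (t * r)).comp t h1

lemma F_growth (S : Setup d p α h₀ θ W h f) (r : ℝ) {t : ℝ} (ht : 1 ≤ t) :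
    t ^ (θ / 2) * Fint f r ≤ Fint f (t * r) := by
  have hder : ∀ x : ℝ, 0 < x → HasDerivAt (fun t => Fint f (t * r) * t ^ (-(θ / 2)))
      (f (x * r) * r * x ^ (-(θ / 2)) +
        Fint f (x * r) * (-(θ / 2) * x ^ (-(θ / 2) - 1))) x := by
    intro x hx
    exact (S.F_comp_deriv r x).mul (Real.hasDerivAt_rpow_const (Or.inl hx.ne'))
  have hmono : MonotoneOn (fun t => Fint f (t * r) * t ^ (-(θ / 2))) (Set.Ici 1) := by
    refine monotoneOn_of_deriv_nonneg (convex_Ici 1) ?_ ?_ ?_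
    · intro x hx
      exact (hder x (lt_of_lt_of_le one_pos hx)).continuousAt.continuousWithinAt
    · intro x hx
      rw [interior_Ici] at hx
      exact (hder x (one_pos.trans hx)).differentiableAt.differentiableWithinAt
    · intro x hx
      rw [interior_Ici] at hx
      have hx0 : 0 < x := one_pos.trans hx
      rw [(hder x hx0).deriv]
      have e : x ^ (-(θ / 2)) = x * x ^ (-(θ / 2) - 1) := by
        nth_rw 2 [← Real.rpow_one x]
        rw [← Real.rpow_add hx0]; ring_nf
      rw [e]
      have h1 := S.AR (x * r)
      have h2 : 0 ≤ x ^ (-(θ / 2) - 1) := Real.rpow_nonneg hx0.le _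
      have h3 : 0 ≤ (f (x * r) * (x * r) - θ / 2 * Fint f (x * r)) * x ^ (-(θ / 2) - 1) :=
        mul_nonneg (by linarith) h2
      linarith
  have h1 := hmono (Set.mem_Ici.2 le_rfl) (Set.mem_Ici.2 ht) ht
  have ht0 : 0 < t := lt_of_lt_of_le one_pos ht
  simp only [one_mul, Real.one_rpow, mul_one] at h1
  have h2 : 0 < t ^ (θ / 2) := Real.rpow_pos_of_pos ht0 _
  rw [Real.rpow_neg ht0.le, ← div_eq_mul_inv, le_div_iff₀ h2] at h1
  linarith

end Setup

namespace Setup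
variable {d : ℕ} {p α h₀ θ : ℝ} {W : Z d → Z d → ℝ} {h : Z d → ℝ} {f : ℝ → ℝ} {u : Z d → ℝ}

lemma F_posp (S : Setup d p α h₀ θ W h f) {t : ℝ} (ht : 0 < t) (u : Z d → ℝ) (x : Z d) :
    Fint f (t * pos u x) = Fint f (t * u x) := by
  unfold pos
  rcases le_total (u x) 0 with h1 | h1
  · rw [max_eq_right h1, mul_zero, S.F_zero le_rfl,
      S.F_zero (mul_nonpos_of_nonneg_of_nonpos ht.le h1)]
  · rw [max_eq_left h1]

lemma b_posp (S : Setup d p α h₀ θ W h f) {t : ℝ} (ht : 0 < t) (u : Z d → ℝ) (x : Z d) :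
    f (t * pos u x) * pos u x = t⁻¹ * (f (t * u x) * (t * u x)) := by
  unfold pos
  rcases le_total (u x) 0 with h1 | h1
  · rw [max_eq_right h1, S.hfz (t * u x) (mul_nonpos_of_nonneg_of_nonpos ht.le h1)]
    simp
  · rw [max_eq_left h1]
    field_simp

lemma bsum_eq (S : Setup d p α h₀ θ W h f) (hu : memH W h p u) {t : ℝ} (ht : 0 < t) :
    ∑' x : Z d, conv d α (fun y => Fint f (t * pos u y)) x * f (t * pos u x) * pos u x =
      t⁻¹ * Phi d α (Fint f) (fun r => f r * r) (fun x => t * u x) := by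
  have hu' := memH_smul ht hu
  have e := conv_sum_eq S.hd S.hα (A := fun x => Fint f (t * u x))
    (B := fun x => f (t * u x) * (t * u x)) (fun _ => S.F_nonneg _) (fun _ => S.b_nonneg _)
    (nice_summable S.hp0 S.hh₀ S.hh1 S.F_nice hu') (nice_summable S.hp0 S.hh₀ S.hh1 S.b_nice hu')
  unfold Phi
  rw [← e, ← tsum_mul_left]
  refine tsum_congr fun x => ?_
  rw [mul_assoc, S.b_posp ht]
  simp_rw [S.F_posp ht]
  ring

lemma energy_eq (S : Setup d p α h₀ θ W h f) (hu : memH W h p u) :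
    energy W h p α f u =
      (1 / p) * HnormP W h p u - (1 / 2) * Phi d α (Fint f) (Fint f) u := by
  have e := conv_sum_eq S.hd S.hα (A := fun x => Fint f (u x))
    (B := fun x => Fint f (u x)) (fun _ => S.F_nonneg _) (fun _ => S.F_nonneg _)
    (nice_summable S.hp0 S.hh₀ S.hh1 S.F_nice hu) (nice_summable S.hp0 S.hh₀ S.hh1 S.F_nice hu)
  unfold energy Phi
  rw [← e]
  have h1 : ∀ x, Fint f (pos u x) = Fint f (u x) := fun x => by
    simpa using S.F_posp one_pos u x
  simp_rw [h1]

lemma mem_nehari (S : Setup d p α h₀ θ W h f) (hu : memH W h p u) :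
    u ∈ Nehari W h p α f ↔
      u ≠ 0 ∧ HnormP W h p u = Phi d α (Fint f) (fun r => f r * r) u := by
  have e := S.bsum_eq hu one_pos
  simp only [one_mul, inv_one] at e
  unfold Nehari
  rw [Set.mem_ofPred_eq, e]
  exact ⟨fun h => h.2, fun h => ⟨hu, h⟩⟩

lemma g_mono (S : Setup d p α h₀ θ W h f) (hu : memH W h p u) (hpos : pos u ≠ 0) :
    StrictMonoOn (fun t : ℝ => t ^ (-p) *
      Phi d α (Fint f) (fun r => f r * r) (fun x => t * u x)) (Set.Ioi 0) := by
  refine (S.hf4 u hu hpos).congr ?_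
  intro t ht
  have ht : 0 < t := ht
  simp only
  rw [S.bsum_eq hu ht, ← mul_assoc, ← Real.rpow_neg_one t, ← Real.rpow_add ht]
  congr 2
  ring

lemma phi_pos (S : Setup d p α h₀ θ W h f) (hu : memH W h p u) (hpos : pos u ≠ 0) :
    0 < Phi d α (Fint f) (fun r => f r * r) u := by
  have h1 := S.g_mono hu hpos (Set.mem_Ioi.2 (by norm_num : (0 : ℝ) < 1 / 2))
    (Set.mem_Ioi.2 one_pos) (by norm_num)
  simp only [Real.one_rpow, one_mul] at h1
  refine lt_of_le_of_lt ?_ h1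
  exact mul_nonneg (Real.rpow_nonneg (by norm_num) _) (Phi_nonneg S.hd S.hα S.F_nice S.b_nice _)

lemma pos_of_phi (S : Setup d p α h₀ θ W h f)
    (hph : 0 < Phi d α (Fint f) (fun r => f r * r) u) : pos u ≠ 0 := by
  intro h0
  have hle : ∀ x, u x ≤ 0 := fun x => by
    have := congrFun h0 x
    simpa [pos] using this
  have : Phi d α (Fint f) (fun r => f r * r) u = 0 := by
    unfold Phi
    simp [S.F_zero (hle _)]
  linarith

lemma phiF_pos (S : Setup d p α h₀ θ W h f) (hu : memH W h p u) (hpos : pos u ≠ 0) :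
    0 < Phi d α (Fint f) (Fint f) u := by
  have h1 := S.phi_pos hu hpos
  by_contra hneg
  have hs := Phi_summable S.hd S.hα S.hp0 S.hh₀ S.hh1 S.F_nice S.F_nice hu
  have hnn : ∀ z : Z d × Z d, 0 ≤ Riesz d α z.1 z.2 * (Fint f (u z.1) * Fint f (u z.2)) :=
    fun _ => mul_nonneg (Riesz_nonneg S.hd S.hα _ _) (mul_nonneg (S.F_nonneg _) (S.F_nonneg _))
  have hz : ∀ z : Z d × Z d, Riesz d α z.1 z.2 * (Fint f (u z.1) * Fint f (u z.2)) = 0 := by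
    intro z
    refine le_antisymm ?_ (hnn z)
    exact (hs.le_tsum z fun y _ => hnn y).trans (not_lt.1 hneg)
  have : Phi d α (Fint f) (fun r => f r * r) u = 0 := by
    unfold Phi
    convert tsum_zero with z
    rcases mul_eq_zero.1 (hz z) with h2 | h2
    · rw [h2, zero_mul]
    rcases mul_eq_zero.1 h2 with h3 | h3
    · have : f (u z.1) = 0 := by
        by_contra h4
        exact (S.F_pos (lt_of_le_of_ne (S.f_nonneg _) (Ne.symm h4))).ne' h3
      simp [this]
    · rw [h3]; simp
  linarith

lemma phi_AR (S : Setup d p α h₀ θ W h f) (hu : memH W h p u) :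
    θ * Phi d α (Fint f) (Fint f) u ≤ 2 * Phi d α (Fint f) (fun r => f r * r) u := by
  have s1 := Phi_summable S.hd S.hα S.hp0 S.hh₀ S.hh1 S.F_nice S.F_nice hu
  have s2 := Phi_summable S.hd S.hα S.hp0 S.hh₀ S.hh1 S.F_nice S.b_nice hu
  unfold Phi
  rw [← tsum_mul_left, ← tsum_mul_left]
  refine Summable.tsum_le_tsum (fun z => ?_) (s1.mul_left _) (s2.mul_left _)
  have h1 := mul_le_mul_of_nonneg_right (S.AR (u z.1))
    (mul_nonneg (Riesz_nonneg S.hd S.hα z.1 z.2) (S.F_nonneg (u z.2)))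
  linarith

lemma phi_growth (S : Setup d p α h₀ θ W h f) (hu : memH W h p u) {t : ℝ} (ht : 1 ≤ t) :
    t ^ θ * Phi d α (Fint f) (Fint f) u ≤ Phi d α (Fint f) (Fint f) (fun x => t * u x) := by
  have ht0 : 0 < t := lt_of_lt_of_le one_pos ht
  have s1 := Phi_summable S.hd S.hα S.hp0 S.hh₀ S.hh1 S.F_nice S.F_nice hu
  have s2 := Phi_summable S.hd S.hα S.hp0 S.hh₀ S.hh1 S.F_nice S.F_nice (memH_smul ht0 hu)
  unfold Phi
  rw [← tsum_mul_left]
  refine Summable.tsum_le_tsum (fun z => ?_) (s1.mul_left _) s2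
  have e : t ^ θ = t ^ (θ / 2) * t ^ (θ / 2) := by
    rw [← Real.rpow_add ht0]; ring_nf
  have h0 : 0 ≤ t ^ (θ / 2) := Real.rpow_nonneg ht0.le _
  have h1 := mul_le_mul (S.F_growth (u z.1) ht) (S.F_growth (u z.2) ht)
    (mul_nonneg h0 (S.F_nonneg _)) (S.F_nonneg _)
  have h2 := mul_le_mul_of_nonneg_left h1 (Riesz_nonneg S.hd S.hα z.1 z.2)
  rw [e]
  linarith

lemma phi_cont (S : Setup d p α h₀ θ W h f) (hu : memH W h p u) {a b : ℝ → ℝ}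
    (ha : Nice p a) (hb : Nice p b) {t : ℝ} (ht : 0 < t) :
    ContinuousAt (fun t : ℝ => Phi d α a b (fun x => t * u x)) t := by
  have hN : 0 ≤ HnormP W h p u := HnormP_nonneg S.hh₀ S.hh1
  have hev : ∀ᶠ r in 𝓝 t, 0 < r ∧ r < t + 1 :=
    (eventually_gt_nhds ht).and (eventually_lt_nhds (by linarith))
  have hb' : ∀ r, 0 < r ∧ r < t + 1 → memH W h p (fun x => r * u x) ∧
      HnormP W h p (fun x => r * u x) ≤ (t + 1) ^ p * HnormP W h p u := by
    rintro r ⟨h1, h2⟩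
    refine ⟨memH_smul h1 hu, ?_⟩
    rw [HnormP_smul h1]
    exact mul_le_mul_of_nonneg_right (Real.rpow_le_rpow h1.le h2.le S.hp0.le) hN
  have ht' := hb' t ⟨ht, by linarith⟩
  refine Phi_tendsto S.hd S.hα S.hp0 S.hh₀ S.hh1 S.hh2 ha hb (hev.mono hb') ht'.1 ht'.2 ?_
  intro x
  exact (continuous_id.mul continuous_const).tendsto t

lemma exists_t (S : Setup d p α h₀ θ W h f) (hu : memH W h p u) (hpos : pos u ≠ 0) {b : ℝ}
    (hb : 0 < b)
    (hk : b ^ p * HnormP W h p u ≤ Phi d α (Fint f) (fun r => f r * r) (fun x => b * u x)) :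
    ∃ t, 0 < t ∧ t ≤ b ∧ (fun x => t * u x) ∈ Nehari W h p α f := by
  have hu0 : u ≠ 0 := by
    rintro rfl
    apply hpos; funext x; simp [pos]
  have hN : 0 < HnormP W h p u := HnormP_pos S.hp0 S.hh₀ S.hh1 hu hu0
  set N := HnormP W h p u with hNdef
  obtain ⟨K, hK, hK'⟩ := Phi_bound (W := W) S.hd S.hα S.hp0 S.hh₀ S.hh1 S.F_nice S.b_nice (b ^ p * N)
  -- small `a`
  obtain ⟨a, ha0, hab, ha⟩ : ∃ a, 0 < a ∧ a ≤ b ∧ K * N * a ^ p ≤ 1 := by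
    have h1 : Tendsto (fun a : ℝ => K * N * a ^ p) (𝓝[>] 0) (𝓝 (K * N * 0 ^ p)) := by
      refine Tendsto.const_mul _ ?_
      exact ((Real.continuousAt_rpow_const 0 p (Or.inr S.hp0.le)).tendsto).mono_left
        nhdsWithin_le_nhds
    rw [Real.zero_rpow S.hp0.ne', mul_zero] at h1
    have h2 := h1.eventually (eventually_le_nhds (one_pos : (0 : ℝ) < 1))
    have h3 : ∀ᶠ a : ℝ in 𝓝[>] 0, 0 < a := self_mem_nhdsWithin
    have h4 : ∀ᶠ a : ℝ in 𝓝[>] 0, a ≤ b := (eventually_le_nhds hb).filter_mono nhdsWithin_le_nhds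
    obtain ⟨a, ⟨h5, h6⟩, h7⟩ := ((h2.and h3).and h4).exists
    exact ⟨a, h6, h7, h5⟩
  have hap : 0 < a ^ p := Real.rpow_pos_of_pos ha0 _
  have hka : Phi d α (Fint f) (fun r => f r * r) (fun x => a * u x) - a ^ p * N ≤ 0 := by
    have h1 := hK' _ (memH_smul ha0 hu) (by
      rw [HnormP_smul ha0]
      exact mul_le_mul_of_nonneg_right (Real.rpow_le_rpow ha0.le hab S.hp0.le) hN.le)
    rw [HnormP_smul ha0, ← hNdef] at h1
    have h2 : K * (a ^ p * N) ^ 2 ≤ a ^ p * N := by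
      have : K * (a ^ p * N) ^ 2 = (K * N * a ^ p) * (a ^ p * N) := by ring
      rw [this]
      exact mul_le_of_le_one_left (by positivity) ha
    linarith
  have hcont : ContinuousOn (fun t : ℝ =>
      Phi d α (Fint f) (fun r => f r * r) (fun x => t * u x) - t ^ p * N) (Set.Icc a b) := by
    intro t ht
    have ht0 : 0 < t := lt_of_lt_of_le ha0 ht.1
    exact ((S.phi_cont hu S.F_nice S.b_nice ht0).sub
      ((Real.continuousAt_rpow_const t p (Or.inr S.hp0.le)).mul
        continuousAt_const)).continuousWithinAt
  obtain ⟨t, ht, ht'⟩ := intermediate_value_Icc hab hcont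
    (show (0 : ℝ) ∈ Set.Icc _ _ from ⟨hka, by linarith⟩)
  have ht0 : 0 < t := lt_of_lt_of_le ha0 ht.1
  refine ⟨t, ht0, ht.2, ?_⟩
  rw [S.mem_nehari (memH_smul ht0 hu), HnormP_smul ht0]
  refine ⟨?_, ?_⟩
  · intro h0
    apply hu0
    funext x
    have := congrFun h0 x
    simpa [ht0.ne'] using this
  · simp only at ht'
    linarith

lemma exists_t' (S : Setup d p α h₀ θ W h f) (hu : memH W h p u) (hpos : pos u ≠ 0) :
    ∃ t, 0 < t ∧ (fun x => t * u x) ∈ Nehari W h p α f := by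
  have hP := S.phiF_pos hu hpos
  set P := Phi d α (Fint f) (Fint f) u with hPdef
  have hθ := S.hθ0
  obtain ⟨b, hb1, hb2⟩ : ∃ b : ℝ, 1 ≤ b ∧ HnormP W h p u ≤ b ^ (θ - p) * (θ / 2 * P) := by
    have h1 : Tendsto (fun b : ℝ => b ^ (θ - p) * (θ / 2 * P)) atTop atTop :=
      (tendsto_rpow_atTop (by linarith [S.hθ])).atTop_mul_const (by positivity)
    obtain ⟨b, h2, h3⟩ := ((h1.eventually (eventually_ge_atTop (HnormP W h p u))).and
      (eventually_ge_atTop 1)).exists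
    exact ⟨b, h3, h2⟩
  have hb0 : 0 < b := lt_of_lt_of_le one_pos hb1
  obtain ⟨t, h1, _, h2⟩ := S.exists_t hu hpos hb0 (by
    have h1 := S.phi_growth hu hb1
    have h2 := S.phi_AR (memH_smul hb0 hu)
    have h3 : 0 ≤ b ^ p := Real.rpow_nonneg hb0.le _
    have h4 : b ^ θ = b ^ p * b ^ (θ - p) := by
      rw [← Real.rpow_add hb0]; ring_nf
    calc b ^ p * HnormP W h p u ≤ b ^ p * (b ^ (θ - p) * (θ / 2 * P)) :=
          mul_le_mul_of_nonneg_left hb2 h3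
      _ = θ / 2 * (b ^ θ * P) := by rw [h4]; ring
      _ ≤ θ / 2 * Phi d α (Fint f) (Fint f) (fun x => b * u x) :=
          mul_le_mul_of_nonneg_left h1 (by positivity)
      _ ≤ _ := by linarith)
  exact ⟨t, h1, h2⟩

end Setup

namespace Setup
variable {d : ℕ} {p α h₀ θ : ℝ} {W : Z d → Z d → ℝ} {h : Z d → ℝ} {f : ℝ → ℝ} {u : Z d → ℝ}

lemma phi_swap (_S : Setup d p α h₀ θ W h f) (a b : ℝ → ℝ) (u : Z d → ℝ) :
    Phi d α b a u = Phi d α a b u := by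
  unfold Phi
  rw [← (Equiv.prodComm (Z d) (Z d)).tsum_eq]
  refine tsum_congr fun z => ?_
  simp only [Equiv.prodComm_apply, Prod.fst_swap, Prod.snd_swap]
  rw [Riesz_symm d α z.2 z.1]
  ring

set_option maxHeartbeats 400000 in
lemma phi_deriv (S : Setup d p α h₀ θ W h f) (hu : memH W h p u) {t₀ : ℝ} (ht₀ : 0 < t₀) :
    HasDerivAt (fun t : ℝ => Phi d α (Fint f) (Fint f) (fun x => t * u x))
      (2 * (t₀⁻¹ * Phi d α (Fint f) (fun r => f r * r) (fun x => t₀ * u x))) t₀ := by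
  have hN : 0 ≤ HnormP W h p u := HnormP_nonneg S.hh₀ S.hh1
  obtain ⟨K, hK, hK'⟩ := Riesz_bdd S.hd S.hα
  obtain ⟨C1, hC1, hC1'⟩ := nice_bound (W := W) S.hp0 S.hh₀ S.hh1 S.F_nice
    ((t₀ + 1) ^ p * HnormP W h p u)
  obtain ⟨C2, hC2, hC2'⟩ := nice_bound (W := W) S.hp0 S.hh₀ S.hh1 S.b_nice
    ((t₀ + 1) ^ p * HnormP W h p u)
  have hT : 0 ≤ (t₀ + 1) ^ p := by positivity
  have hab : ∀ t ∈ Set.Ioo (t₀ / 2) (t₀ + 1), ∀ x, |t * u x| ^ p ≤ (t₀ + 1) ^ p * |u x| ^ p := by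
    intro t ht x
    have h0 : 0 < t := by linarith [ht.1]
    rw [abs_mul, abs_of_pos h0, Real.mul_rpow h0.le (abs_nonneg _)]
    gcongr
    · exact S.hp0.le
    · exact ht.2.le
  have hmem : ∀ t ∈ Set.Ioo (t₀ / 2) (t₀ + 1), memH W h p (fun x => t * u x) ∧
      HnormP W h p (fun x => t * u x) ≤ (t₀ + 1) ^ p * HnormP W h p u := by
    rintro r ⟨h1, h2⟩
    have h1 : 0 < r := by linarith
    refine ⟨memH_smul h1 hu, ?_⟩
    rw [HnormP_smul h1]
    exact mul_le_mul_of_nonneg_right (Real.rpow_le_rpow h1.le h2.le S.hp0.le) hN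
  have hF : ∀ t ∈ Set.Ioo (t₀ / 2) (t₀ + 1), ∀ x,
      Fint f (t * u x) ≤ C1 * (t₀ + 1) ^ p * |u x| ^ p := by
    intro t ht x
    refine (hC1' _ (hmem t ht).1 (hmem t ht).2 x).trans ?_
    rw [mul_assoc]
    exact mul_le_mul_of_nonneg_left (hab t ht x) hC1
  have hB : ∀ t ∈ Set.Ioo (t₀ / 2) (t₀ + 1), ∀ x,
      f (t * u x) * u x ≤ 2 / t₀ * (C2 * (t₀ + 1) ^ p) * |u x| ^ p := by
    intro t ht x
    have h1 : f (t * u x) * (t * u x) ≤ C2 * (t₀ + 1) ^ p * |u x| ^ p := by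
      refine (hC2' _ (hmem t ht).1 (hmem t ht).2 x).trans ?_
      rw [mul_assoc]
      exact mul_le_mul_of_nonneg_left (hab t ht x) hC2
    have h0 : 0 < t := by linarith [ht.1]
    have h2 : f (t * u x) * u x = t⁻¹ * (f (t * u x) * (t * u x)) := by field_simp
    have h3 : t⁻¹ ≤ 2 / t₀ := by
      rw [inv_le_comm₀ h0 (by positivity), inv_div]
      exact ht.1.le
    rw [h2, mul_assoc]
    exact mul_le_mul h3 h1 (S.b_nonneg _) (by positivity)
  have hBn : ∀ t ∈ Set.Ioo (t₀ / 2) (t₀ + 1), ∀ x, 0 ≤ f (t * u x) * u x := by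
    intro t ht x
    have h0 : 0 < t := by linarith [ht.1]
    have h2 : f (t * u x) * u x = t⁻¹ * (f (t * u x) * (t * u x)) := by field_simp
    rw [h2]
    exact mul_nonneg (by positivity) (S.b_nonneg _)
  have hD1 : 0 ≤ C1 * (t₀ + 1) ^ p := by positivity
  have hD2 : 0 ≤ 2 / t₀ * (C2 * (t₀ + 1) ^ p) := by positivity
  generalize C1 * (t₀ + 1) ^ p = D1 at hF hD1
  generalize 2 / t₀ * (C2 * (t₀ + 1) ^ p) = D2 at hB hD2
  obtain ⟨s1, s2⟩ := memH_p S.hh₀ S.hh1 hu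
  have hn : ∀ x, 0 ≤ |u x| ^ p := fun x => Real.rpow_nonneg (abs_nonneg _) _
  have sp := s1.mul_of_nonneg s1 hn hn
  have ht₀m : t₀ ∈ Set.Ioo (t₀ / 2) (t₀ + 1) := ⟨by linarith, by linarith⟩
  have hg : ∀ (z : Z d × Z d) (t : ℝ), t ∈ Set.Ioo (t₀ / 2) (t₀ + 1) →
      HasDerivAt (fun t : ℝ => Riesz d α z.1 z.2 * (Fint f (t * u z.1) * Fint f (t * u z.2)))
      (Riesz d α z.1 z.2 * (f (t * u z.1) * u z.1 * Fint f (t * u z.2) +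
        Fint f (t * u z.1) * (f (t * u z.2) * u z.2))) t := fun z t _ =>
    ((S.F_comp_deriv (u z.1) t).mul (S.F_comp_deriv (u z.2) t)).const_mul _
  have hg' : ∀ (z : Z d × Z d) (t : ℝ), t ∈ Set.Ioo (t₀ / 2) (t₀ + 1) →
      ‖Riesz d α z.1 z.2 * (f (t * u z.1) * u z.1 * Fint f (t * u z.2) +
        Fint f (t * u z.1) * (f (t * u z.2) * u z.2))‖ ≤
      K * (2 * (D1 * D2)) * (|u z.1| ^ p * |u z.2| ^ p) := by
    intro z t ht
    have e1 := hBn t ht z.1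
    have e2 := hBn t ht z.2
    have e3 := S.F_nonneg (t * u z.1)
    have e4 := S.F_nonneg (t * u z.2)
    rw [Real.norm_of_nonneg (mul_nonneg (Riesz_nonneg S.hd S.hα _ _)
      (add_nonneg (mul_nonneg e1 e4) (mul_nonneg e3 e2)))]
    have i1 := mul_le_mul (hB t ht z.1) (hF t ht z.2) e4 (mul_nonneg hD2 (hn _))
    have i2 := mul_le_mul (hF t ht z.1) (hB t ht z.2) e2 (mul_nonneg hD1 (hn _))
    calc Riesz d α z.1 z.2 * (f (t * u z.1) * u z.1 * Fint f (t * u z.2) +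
        Fint f (t * u z.1) * (f (t * u z.2) * u z.2))
        ≤ K * (D2 * |u z.1| ^ p * (D1 * |u z.2| ^ p) +
          D1 * |u z.1| ^ p * (D2 * |u z.2| ^ p)) :=
          mul_le_mul (hK' _ _) (add_le_add i1 i2)
            (add_nonneg (mul_nonneg e1 e4) (mul_nonneg e3 e2)) hK.le
      _ = K * (2 * (D1 * D2)) * (|u z.1| ^ p * |u z.2| ^ p) := by ring
  have hsum0 : Summable fun z : Z d × Z d =>
      Riesz d α z.1 z.2 * (Fint f (t₀ * u z.1) * Fint f (t₀ * u z.2)) :=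
    Phi_summable (a := Fint f) (b := Fint f) (u := fun x => t₀ * u x)
      S.hd S.hα S.hp0 S.hh₀ S.hh1 S.F_nice S.F_nice (memH_smul ht₀ hu)
  have sp' : Summable fun z : Z d × Z d =>
      K * (2 * (D1 * D2)) * (|u z.1| ^ p * |u z.2| ^ p) :=
    sp.mul_left (K * (2 * (D1 * D2)))
  have key : HasDerivAt (fun t : ℝ => ∑' z : Z d × Z d,
      Riesz d α z.1 z.2 * (Fint f (t * u z.1) * Fint f (t * u z.2)))
      (∑' z : Z d × Z d, Riesz d α z.1 z.2 * (f (t₀ * u z.1) * u z.1 * Fint f (t₀ * u z.2) +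
        Fint f (t₀ * u z.1) * (f (t₀ * u z.2) * u z.2))) t₀ :=
    hasDerivAt_tsum_of_isPreconnected
      (g := fun (z : Z d × Z d) (t : ℝ) =>
        Riesz d α z.1 z.2 * (Fint f (t * u z.1) * Fint f (t * u z.2)))
      (g' := fun (z : Z d × Z d) (t : ℝ) =>
        Riesz d α z.1 z.2 * (f (t * u z.1) * u z.1 * Fint f (t * u z.2) +
        Fint f (t * u z.1) * (f (t * u z.2) * u z.2)))
      sp' isOpen_Ioo isPreconnected_Ioo hg hg' ht₀m hsum0 ht₀m
  have t1 := Phi_summable S.hd S.hα S.hp0 S.hh₀ S.hh1 S.F_nice S.b_nice (memH_smul ht₀ hu)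
  have t2 := Phi_summable S.hd S.hα S.hp0 S.hh₀ S.hh1 S.b_nice S.F_nice (memH_smul ht₀ hu)
  have e := S.phi_swap (Fint f) (fun r => f r * r) (fun x => t₀ * u x)
  have hval : ∑' z : Z d × Z d, Riesz d α z.1 z.2 *
      (f (t₀ * u z.1) * u z.1 * Fint f (t₀ * u z.2) +
        Fint f (t₀ * u z.1) * (f (t₀ * u z.2) * u z.2)) =
      2 * (t₀⁻¹ * Phi d α (Fint f) (fun r => f r * r) (fun x => t₀ * u x)) := by
    rw [two_mul]
    nth_rw 2 [← e]
    unfold Phi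
    rw [← mul_add, ← t1.tsum_add t2, ← tsum_mul_left]
    refine tsum_congr fun z => ?_
    field_simp
  rw [hval] at key
  exact key

lemma energy_le (S : Setup d p α h₀ θ W h f) (hu : memH W h p u) (hM : u ∈ Nehari W h p α f)
    {t : ℝ} (ht : 0 < t) (ht1 : t ≤ 1) :
    (1 / p) * (t ^ p * HnormP W h p u) -
      (1 / 2) * Phi d α (Fint f) (Fint f) (fun x => t * u x) ≤ energy W h p α f u := by
  obtain ⟨hu0, hN⟩ := (S.mem_nehari hu).1 hM
  have hNpos := HnormP_pos S.hp0 S.hh₀ S.hh1 hu hu0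
  have hpos : pos u ≠ 0 := S.pos_of_phi (hN ▸ hNpos)
  rw [S.energy_eq hu]
  set N := HnormP W h p u with hNdef
  have hder : ∀ r : ℝ, 0 < r → HasDerivAt (fun r : ℝ => (1 / p) * (r ^ p * N) -
      (1 / 2) * Phi d α (Fint f) (Fint f) (fun x => r * u x))
      ((1 / p) * (p * r ^ (p - 1) * N) - (1 / 2) *
        (2 * (r⁻¹ * Phi d α (Fint f) (fun r => f r * r) (fun x => r * u x)))) r := by
    intro r hr
    exact (((Real.hasDerivAt_rpow_const (Or.inl hr.ne')).mul_const N).const_mul _).sub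
      ((S.phi_deriv hu hr).const_mul _)
  have hmono : MonotoneOn (fun r : ℝ => (1 / p) * (r ^ p * N) -
      (1 / 2) * Phi d α (Fint f) (Fint f) (fun x => r * u x)) (Set.Icc t 1) := by
    refine monotoneOn_of_deriv_nonneg (convex_Icc _ _) ?_ ?_ ?_
    · intro x hx
      exact (hder x (lt_of_lt_of_le ht hx.1)).continuousAt.continuousWithinAt
    · intro x hx
      rw [interior_Icc] at hx
      exact (hder x (ht.trans hx.1)).differentiableAt.differentiableWithinAt
    · intro x hx
      rw [interior_Icc] at hx
      have hx0 := ht.trans hx.1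
      rw [(hder x hx0).deriv]
      have h1 := S.g_mono hu hpos (Set.mem_Ioi.2 hx0) (Set.mem_Ioi.2 one_pos) hx.2
      simp only [Real.one_rpow, one_mul] at h1
      rw [← hN] at h1
      have hp := S.hp0
      have hxp : 0 < x ^ p := Real.rpow_pos_of_pos hx0 _
      rw [Real.rpow_neg hx0.le, inv_mul_lt_iff₀ hxp] at h1
      have e : x ^ (p - 1) = x⁻¹ * x ^ p := by
        rw [Real.rpow_sub_one hx0.ne']; field_simp
      have h2 := mul_le_mul_of_nonneg_left h1.le (inv_nonneg.2 hx0.le)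
      have e2 : (1 / p) * (p * x ^ (p - 1) * N) = x⁻¹ * (x ^ p * N) := by
        rw [e]; field_simp
      rw [e2]
      linarith
  have := hmono ⟨le_rfl, ht1⟩ ⟨ht1, le_rfl⟩ ht1
  simpa using this

lemma fatou (S : Setup d p α h₀ θ W h f) {U : ℕ → Z d → ℝ} (hU : ∀ n, memH W h p (U n))
    (hpt : ∀ x, Tendsto (fun n => U n x) atTop (𝓝 (u x))) {A : ℕ → ℝ} {L : ℝ}
    (hA : ∀ n, HnormP W h p (U n) ≤ A n) (hL : Tendsto A atTop (𝓝 L)) :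
    memH W h p u ∧ HnormP W h p u ≤ L := by
  have hp0 := S.hp0
  have hterm : ∀ (v : Z d → ℝ) (x y : Z d), 0 ≤ W x y * (v x - v y) ^ 2 := fun v x y =>
    mul_nonneg (S.hW x y).le (sq_nonneg _)
  have step1 : ∀ T X : Finset (Z d), ∑ x ∈ X,
      (Real.sqrt ((1 / 2) * ∑ y ∈ T, W x y * (u x - u y) ^ 2) ^ p + h x * |u x| ^ p) ≤ L := by
    intro T X
    have hlim : Tendsto (fun n => ∑ x ∈ X,
      (Real.sqrt ((1 / 2) * ∑ y ∈ T, W x y * (U n x - U n y) ^ 2) ^ p + h x * |U n x| ^ p)) atTop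
      (𝓝 (∑ x ∈ X,
      (Real.sqrt ((1 / 2) * ∑ y ∈ T, W x y * (u x - u y) ^ 2) ^ p + h x * |u x| ^ p))) := by
      refine tendsto_finsetSum _ fun x _ => Tendsto.add ?_ ?_
      · refine Tendsto.rpow_const ?_ (Or.inr hp0.le)
        refine (Real.continuous_sqrt.tendsto _).comp (Tendsto.const_mul _ ?_)
        exact tendsto_finsetSum _ fun y _ => (((hpt x).sub (hpt y)).pow 2).const_mul _
      · exact ((hpt x).abs.rpow_const (Or.inr hp0.le)).const_mul _
    refine le_of_tendsto_of_tendsto' hlim hL fun n => le_trans ?_ (hA n)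
    refine le_trans ?_ ((hU n).2.sum_le_tsum X
      fun x _ => add_nonneg (grad_nonneg x) (term_nonneg S.hh₀ S.hh1 x))
    refine Finset.sum_le_sum fun x _ => ?_
    have := ((hU n).1 x).sum_le_tsum T fun y _ => hterm (U n) x y
    unfold gradNorm
    gcongr
  have hsum : ∀ x : Z d, Summable fun y : Z d => W x y * (u x - u y) ^ 2 := by
    intro x
    refine summable_of_sum_le (c := 2 * (L ^ (1 / p)) ^ 2) (hterm u x) fun T => ?_
    have h1 := step1 T {x}
    rw [Finset.sum_singleton] at h1
    have h2 : Real.sqrt ((1 / 2) * ∑ y ∈ T, W x y * (u x - u y) ^ 2) ^ p ≤ L := by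
      linarith [term_nonneg (u := u) (p := p) S.hh₀ S.hh1 x]
    have h3 := Real.rpow_le_rpow (Real.rpow_nonneg (Real.sqrt_nonneg _) _) h2
      (by positivity : 0 ≤ 1 / p)
    rw [← Real.rpow_mul (Real.sqrt_nonneg _), mul_one_div_cancel hp0.ne', Real.rpow_one] at h3
    have h4 : 0 ≤ (1 / 2) * ∑ y ∈ T, W x y * (u x - u y) ^ 2 :=
      mul_nonneg (by norm_num) (Finset.sum_nonneg fun y _ => hterm u x y)
    have h5 := pow_le_pow_left₀ (Real.sqrt_nonneg _) h3 2
    rw [Real.sq_sqrt h4] at h5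
    linarith
  have step2 : ∀ X : Finset (Z d), ∑ x ∈ X, (gradNorm W u x ^ p + h x * |u x| ^ p) ≤ L := by
    intro X
    have hlim : Tendsto (fun T : Finset (Z d) => ∑ x ∈ X,
      (Real.sqrt ((1 / 2) * ∑ y ∈ T, W x y * (u x - u y) ^ 2) ^ p + h x * |u x| ^ p)) atTop
      (𝓝 (∑ x ∈ X, (gradNorm W u x ^ p + h x * |u x| ^ p))) := by
      refine tendsto_finsetSum _ fun x _ => Tendsto.add ?_ tendsto_const_nhds
      refine Tendsto.rpow_const ?_ (Or.inr hp0.le)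
      exact (Real.continuous_sqrt.tendsto _).comp (Tendsto.const_mul _ (hsum x).hasSum)
    exact le_of_tendsto' hlim fun T => step1 T X
  have hnn : ∀ x, 0 ≤ gradNorm W u x ^ p + h x * |u x| ^ p := fun x =>
    add_nonneg (grad_nonneg x) (term_nonneg S.hh₀ S.hh1 x)
  exact ⟨⟨hsum, summable_of_sum_le hnn step2⟩, Real.tsum_le_of_sum_le hnn step2⟩

end Setup

lemma lat_mem {d : ℕ} (x : Z d) : (fun i => (x i : ℝ) : Fin d → ℝ) ∈
    Submodule.span ℤ (Set.range (Pi.basisFun ℝ (Fin d))) := by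
  have : (fun i => (x i : ℝ) : Fin d → ℝ) = ∑ i, x i • Pi.basisFun ℝ (Fin d) i := by
    funext j
    simp [Finset.sum_apply, Pi.single_apply]
  rw [this]
  exact Submodule.sum_mem _ fun i _ => Submodule.smul_mem _ _ (Submodule.subset_span ⟨i, rfl⟩)

lemma lat_rank (d : ℕ) :
    Module.finrank ℤ (Submodule.span ℤ (Set.range (Pi.basisFun ℝ (Fin d)))) = d := by
  rw [ZLattice.rank ℝ]; simp

lemma lat_inj (d : ℕ) : Function.Injective (fun x : Z d =>
    (⟨(fun i => (x i : ℝ) : Fin d → ℝ), lat_mem x⟩ :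
      (Submodule.span ℤ (Set.range (Pi.basisFun ℝ (Fin d)))))) := by
  intro x y hxy
  have h1 := congrArg Subtype.val hxy
  funext i
  have h2 := congrFun h1 i
  simpa using h2

lemma summable_lat {d : ℕ} {r : ℝ} (hr : r < -(d : ℝ)) :
    Summable fun x : Z d => ‖(fun i => (x i : ℝ) : Fin d → ℝ)‖ ^ r := by
  have hs := ZLattice.summable_norm_rpow (Submodule.span ℤ (Set.range (Pi.basisFun ℝ (Fin d)))) r
    (by rw [lat_rank]; exact hr)
  have h2 := hs.comp_injective (lat_inj d)
  refine h2.congr fun x => ?_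
  rw [Function.comp_apply, Submodule.coe_norm]

lemma summable_W {d : ℕ} {s : ℝ} (hs : 0 < s) {W : Z d → Z d → ℝ} (hW : KernelOK d s W) :
    Summable fun y : Z d => W 0 y := by
  obtain ⟨_, hpos, c, C, hc, hcC, hb⟩ := hW
  have hC : 0 < C := hc.trans_le hcC
  have hr : -(d : ℝ) - 2 * s < -(d : ℝ) := by linarith
  have hr0 : -(d : ℝ) - 2 * s ≤ 0 := by
    have : (0 : ℝ) ≤ d := Nat.cast_nonneg d
    linarith
  refine Summable.of_norm_bounded_eventually ((summable_lat hr).mul_left C) ?_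
  have hfin : ({0} : Set (Z d)).Finite := Set.finite_singleton 0
  refine hfin.subset ?_
  intro y hy
  by_contra hy0
  apply hy
  have hy0 : y ≠ 0 := hy0
  rw [Set.mem_ofPred_eq]
  rw [Real.norm_of_nonneg (hpos 0 y).le]
  refine (hb 0 y hy0.symm).2.trans (mul_le_mul_of_nonneg_left ?_ hC.le)
  refine Real.rpow_le_rpow_of_nonpos ?_ ?_ hr0
  · rw [norm_pos_iff]
    intro h0
    apply hy0
    funext i
    have := congrFun h0 i
    simpa using this
  · rw [pi_norm_le_iff_of_nonneg (show 0 ≤ latDist 0 y from Finset.sum_nonneg fun i _ => abs_nonneg _)]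
    intro i
    have := Finset.single_le_sum (f := fun i => |(((0 : Z d) i - y i : ℤ) : ℝ)|)
      (fun i _ => abs_nonneg _) (Finset.mem_univ i)
    unfold latDist
    simpa using this

lemma exists_memH {d : ℕ} {s p : ℝ} (hs : 0 < s) (hp : 2 ≤ p) {W : Z d → Z d → ℝ}
    (hW : KernelOK d s W) (h : Z d → ℝ) :
    ∃ u : Z d → ℝ, memH W h p u ∧ pos u ≠ 0 := by
  have sW := summable_W hs hW
  obtain ⟨hsym, hpos, _⟩ := hW
  let u : Z d → ℝ := Pi.single 0 1
  have hu0 : u 0 = 1 := by simp [u]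
  have hux : ∀ x, x ≠ 0 → u x = 0 := fun x hx => by simp [u, hx]
  have hx1 : ∀ x : Z d, x ≠ 0 → ∀ y, y ≠ 0 → W x y * (u x - u y) ^ 2 = 0 := by
    intro x hx y hy
    rw [hux x hx, hux y hy]; simp
  have hgrad : ∀ x : Z d, x ≠ 0 → gradNorm W u x ^ p = ((1 / 2) * W 0 x) ^ (p / 2) := by
    intro x hx
    unfold gradNorm
    rw [tsum_eq_single 0 (hx1 x hx), hux x hx, hu0, hsym x 0, Real.sqrt_eq_rpow,
      ← Real.rpow_mul (by have := (hpos 0 x).le; positivity)]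
    congr 1
    · ring
    · ring
  refine ⟨u, ⟨?_, ?_⟩, ?_⟩
  · intro x
    by_cases hx : x = 0
    · subst hx
      refine sW.of_nonneg_of_le (fun y => mul_nonneg (hpos _ _).le (sq_nonneg _)) fun y => ?_
      by_cases hy : y = 0
      · subst hy; simp [(hpos 0 0).le]
      · rw [hu0, hux y hy]; simp
    · exact summable_of_ne_finset_zero (s := {0}) fun y hy => hx1 x hx y (by simpa using hy)
  · refine Summable.add ?_ ?_
    · refine Summable.of_norm_bounded_eventually sW ?_
      have h1 : ∀ᶠ x in cofinite, W 0 x ≤ 1 :=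
        sW.tendsto_cofinite_zero.eventually (eventually_le_nhds one_pos)
      have h2 : ∀ᶠ x : Z d in cofinite, x ≠ 0 := by
        have : ({0} : Set (Z d)).Finite := Set.finite_singleton 0
        exact this.compl_mem_cofinite
      filter_upwards [h1, h2] with x hx hx0
      rw [hgrad x hx0]
      have hw := (hpos 0 x)
      rw [Real.norm_of_nonneg (Real.rpow_nonneg (by positivity) _)]
      calc ((1 / 2) * W 0 x) ^ (p / 2) ≤ ((1 / 2) * W 0 x) ^ (1 : ℝ) :=
            Real.rpow_le_rpow_of_exponent_ge (by positivity) (by linarith) (by linarith)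
        _ ≤ W 0 x := by rw [Real.rpow_one]; linarith
    · refine summable_of_ne_finset_zero (s := {0}) fun x hx => ?_
      rw [hux x (by simpa using hx), abs_zero, Real.zero_rpow (by linarith), mul_zero]
  · intro h0
    have := congrFun h0 0
    simp [pos, hu0] at this

theorem nehari_infimum_attained
    {d : ℕ} (hd : 0 < d) {s p : ℝ} (hs : s ∈ Set.Ioo (0 : ℝ) 1) (hp : 2 ≤ p)
    {W : Z d → Z d → ℝ} (hW : KernelOK d s W)
    {α : ℝ} (hα : α ∈ Set.Ioo (0 : ℝ) (d : ℝ))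
    {h : Z d → ℝ} {h₀ : ℝ} (hh₀ : 0 < h₀) (hh1 : ∀ x, h₀ ≤ h x)
    (hh2 : H2 h)
    {f : ℝ → ℝ} (hfc : Continuous f) (hfz : ∀ t ≤ (0 : ℝ), f t = 0)
    (hf1 : F1 f p)
    {C₀ τ : ℝ} (hC₀ : 0 < C₀) (hτ : ((d : ℝ) + α) * p / (2 * d) < τ)
    (hf2 : ∀ t > (0 : ℝ), f t ≤ C₀ * (1 + t ^ (τ - 1)))
    {θ : ℝ} (hθ : p < θ) (hf3 : F3 f θ)
    (hf4 : F4 W h p α f)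
 :
    ∃ u₀ ∈ Nehari W h p α f, 0 < energy W h p α f u₀ ∧
      ∀ v ∈ Nehari W h p α f, energy W h p α f u₀ ≤ energy W h p α f v := by
  have S : Setup d p α h₀ θ W h f :=
    ⟨hd, hp, hα, hW.2.1, hh₀, hh1, hh2, hfc, hfz, hf1, hθ, hf3, hf4⟩
  have hp0 := S.hp0
  have hθ0 := S.hθ0
  set κ : ℝ := 1 / p - 1 / θ with hκ
  have hκ0 : 0 < κ := sub_pos.2 (one_div_lt_one_div_of_lt hp0 hθ)
  -- coercivity on the Nehari set
  have hcoer : ∀ v ∈ Nehari W h p α f, κ * HnormP W h p v ≤ energy W h p α f v := by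
    intro v hv
    have hm : memH W h p v := hv.1
    obtain ⟨_, hN⟩ := (S.mem_nehari hm).1 hv
    rw [S.energy_eq hm]
    have h1 := S.phi_AR hm
    rw [← hN] at h1
    have h2 : (1 / 2) * Phi d α (Fint f) (Fint f) v ≤ 1 / θ * HnormP W h p v := by
      rw [div_mul_eq_mul_div, div_mul_eq_mul_div, le_div_iff₀ hθ0]
      linarith
    rw [hκ, sub_mul]
    linarith
  have hNpos : ∀ v ∈ Nehari W h p α f, 0 < HnormP W h p v := fun v hv =>
    HnormP_pos hp0 hh₀ hh1 hv.1 hv.2.1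
  have hEpos : ∀ v ∈ Nehari W h p α f, 0 < energy W h p α f v := fun v hv =>
    (mul_pos hκ0 (hNpos v hv)).trans_le (hcoer v hv)
  -- lower bound on the norm
  obtain ⟨ρ, hρ, hρ'⟩ : ∃ ρ : ℝ, 0 < ρ ∧ ∀ v ∈ Nehari W h p α f, ρ ≤ HnormP W h p v := by
    obtain ⟨K, hK, hK'⟩ := Phi_bound (W := W) hd hα hp0 hh₀ hh1 S.F_nice S.b_nice 1
    refine ⟨min 1 (1 / (K + 1)), by positivity, fun v hv => ?_⟩
    rcases le_or_gt (HnormP W h p v) 1 with h1 | h1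
    · refine (min_le_right _ _).trans ?_
      have h2 := hK' v hv.1 h1
      rw [← ((S.mem_nehari hv.1).1 hv).2] at h2
      have h3 := hNpos v hv
      rw [div_le_iff₀ (by linarith)]
      have h4 : 1 ≤ K * HnormP W h p v := by
        by_contra h5
        push Not at h5
        nlinarith
      nlinarith
    · exact (min_le_left _ _).trans h1.le
  -- nonemptiness
  have hne : (Nehari W h p α f).Nonempty := by
    obtain ⟨u, hu, hpos⟩ := exists_memH hs.1 hp hW h
    obtain ⟨t, _, ht⟩ := S.exists_t' hu hpos
    exact ⟨_, ht⟩
  -- minimizing sequence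
  set E : Set ℝ := energy W h p α f '' Nehari W h p α f with hE
  have hEbdd : BddBelow E := ⟨0, by rintro _ ⟨v, hv, rfl⟩; exact (hEpos v hv).le⟩
  obtain ⟨e, _, het, heE⟩ := exists_seq_tendsto_sInf (hne.image _) hEbdd
  choose U hUM hUe using heE
  have hUm : ∀ n, memH W h p (U n) := fun n => (hUM n).1
  obtain ⟨M, hM⟩ := het.bddAbove_range
  set B := M / κ with hB
  have hUB : ∀ n, HnormP W h p (U n) ≤ B := by
    intro n
    rw [hB, le_div_iff₀ hκ0, mul_comm]
    exact (hcoer _ (hUM n)).trans ((hUe n).le.trans (hM ⟨n, rfl⟩))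
  -- convergent subsequence
  obtain ⟨u, _, φ, hφ, hlim⟩ := (isCompact_univ_pi (X := fun _ : Z d => ℝ)
    (s := fun _ => Set.Icc (-((B / h₀) ^ (1 / p))) ((B / h₀) ^ (1 / p)))
    fun _ => isCompact_Icc).tendsto_subseq (x := U)
      (fun n x _ => abs_le.1 (memH_sup hp0 hh₀ hh1 (hUm n) (hUB n) x))
  rw [tendsto_pi_nhds] at hlim
  obtain ⟨hu, huB⟩ := S.fatou (U := U ∘ φ) (fun n => hUm _) hlim (A := fun _ => B)
    (fun n => hUB _) tendsto_const_nhds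
  have hPhi := Phi_tendsto (α := α) hd hα hp0 hh₀ hh1 hh2 S.F_nice S.b_nice
    (U := U ∘ φ) (B := B) (Eventually.of_forall fun n => ⟨hUm (φ n), hUB (φ n)⟩) hu huB hlim
  have hEq : ∀ n, HnormP W h p (U n) = Phi d α (Fint f) (fun r => f r * r) (U n) := fun n =>
    ((S.mem_nehari (hUm n)).1 (hUM n)).2
  have hphi_pos : 0 < Phi d α (Fint f) (fun r => f r * r) u := by
    refine hρ.trans_le (ge_of_tendsto' hPhi fun n => ?_)
    exact (hρ' _ (hUM (φ n))).trans (hEq _).le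
  have hpos := S.pos_of_phi hphi_pos
  obtain ⟨_, hle⟩ := S.fatou (U := U ∘ φ) (fun n => hUm _) hlim
    (fun n => (hEq (φ n)).le) hPhi
  obtain ⟨t, ht0, ht1, htM⟩ := S.exists_t hu hpos one_pos (by simpa using hle)
  refine ⟨_, htM, hEpos _ htM, fun v hv => ?_⟩
  have hinf : sInf E ≤ energy W h p α f v := csInf_le hEbdd ⟨v, hv, rfl⟩
  refine le_trans ?_ hinf
  -- lower semicontinuity along the scaled sequence
  have htm := memH_smul ht0 hu
  rw [S.energy_eq htm, HnormP_smul ht0]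
  have htB : ∀ w : Z d → ℝ, memH W h p w → HnormP W h p w ≤ B →
      memH W h p (fun x => t * w x) ∧ HnormP W h p (fun x => t * w x) ≤ t ^ p * B := by
    intro w hw hwB
    refine ⟨memH_smul ht0 hw, ?_⟩
    rw [HnormP_smul ht0]
    exact mul_le_mul_of_nonneg_left hwB (Real.rpow_nonneg ht0.le _)
  have hPhiF := Phi_tendsto (α := α) (a := Fint f) (b := Fint f) hd hα hp0 hh₀ hh1 hh2
    S.F_nice S.F_nice
    (U := fun n x => t * U (φ n) x) (u := fun x => t * u x) (B := t ^ p * B)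
    (Eventually.of_forall fun n => htB _ (hUm (φ n)) (hUB (φ n))) (htB u hu huB).1
    (htB u hu huB).2 (fun x => (hlim x).const_mul t)
  have hL : Tendsto (fun n => (1 / p) * (t ^ p * HnormP W h p (U (φ n))) -
      (1 / 2) * Phi d α (Fint f) (Fint f) (fun x => t * U (φ n) x)) atTop
      (𝓝 ((1 / p) * (t ^ p * Phi d α (Fint f) (fun r => f r * r) u) -
      (1 / 2) * Phi d α (Fint f) (Fint f) (fun x => t * u x))) := by
    simp_rw [hEq]
    exact ((hPhi.const_mul _).const_mul _).sub (hPhiF.const_mul _)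
  have hR : Tendsto (fun n => e (φ n)) atTop (𝓝 (sInf E)) := het.comp hφ.tendsto_atTop
  have hfinal := le_of_tendsto_of_tendsto' hL hR fun n => by
    rw [← hUe (φ n)]
    exact S.energy_le (hUm _) (hUM _) ht0 ht1
  refine le_trans ?_ hfinal
  have : 0 ≤ t ^ p := Real.rpow_nonneg ht0.le _
  gcongr


end DiscreteChoquard
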